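/- arXiv:1503.04519 — 3 statements merged into one kernel-verified Lean document; each statement's English description precedes it below -/
import Mathlib

section
/- Let p_0 ≥ 10^20 and let p > p_0 be prime. If p^{1/16} > 3.5751 · (1 − 2/p_0^{1/2})^{−1/2} · (log p)^{1/4} · (2^{ω(p−1)} − 1), then g(p) < √p − 2. -/
/-- The least primitive root modulo `p`: the smallest positive integer whose
residue class has order `p - 1` in `ZMod p` (equivalently, generates `(ZMod p)ˣ`). -/
noncomputable def leastPrimitiveRoot (p : ℕ) : ℕ :=
  sInf {n : ℕ | 0 < n ∧ orderOf ((n : ZMod p)) = p - 1}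

section

open Polynomial

/-- The operator `q ↦ T q' + L q` on polynomials. -/
noncomputable def twistedDerivative {F : Type*} [Field F] (T L : F[X]) : F[X] →ₗ[F] F[X] :=
  LinearMap.mulLeft F T ∘ₗ derivative + LinearMap.mulLeft F L

theorem twistedDerivative_apply {F : Type*} [Field F] (T L q : F[X]) :
    twistedDerivative T L q = T * derivative q + L * q := rfl

theorem natDegree_twistedDerivative_le {F : Type*} [Field F] {T L : F[X]}
    (hT : T.natDegree ≤ 4) (hL : L.natDegree ≤ 3) (q : F[X]) :
    (twistedDerivative T L q).natDegree ≤ q.natDegree + 3 := by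
  rw [twistedDerivative_apply]
  refine (natDegree_add_le _ _).trans (max_le ?_ ?_)
  · by_cases h0 : q.natDegree = 0
    · rw [natDegree_eq_zero] at h0
      obtain ⟨c, rfl⟩ := h0
      simp
    · have h1 := natDegree_mul_le (p := T) (q := derivative q)
      have h2 := natDegree_derivative_le q
      omega
  · have h1 := natDegree_mul_le (p := L) (q := q)
    omega

theorem natDegree_twistedDerivative_pow_le {F : Type*} [Field F] {T L : F[X]}
    (hT : T.natDegree ≤ 4) (hL : L.natDegree ≤ 3) (q : F[X]) (s : ℕ) :
    ((twistedDerivative T L ^ s) q).natDegree ≤ q.natDegree + 3 * s := by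
  induction s with
  | zero => simp
  | succ s ih =>
    rw [pow_succ', Module.End.mul_apply]
    have := natDegree_twistedDerivative_le hT hL ((twistedDerivative T L ^ s) q)
    omega

/-- If `E` is an eigenvector of `T d/dx` with eigenvalue `L`, then the operator `T d/dx` acts on
multiples of `E` as a twisted derivative. -/
theorem twistedDerivative_zero_pow_mul {F : Type*} [Field F] {T L E : F[X]}
    (hE : T * derivative E = L * E) (q : F[X]) (s : ℕ) :
    (twistedDerivative T 0 ^ s) (q * E) = (twistedDerivative T L ^ s) q * E := by
  induction s with
  | zero => simp
  | succ s ih =>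
    rw [pow_succ', Module.End.mul_apply, ih, pow_succ', Module.End.mul_apply,
      twistedDerivative_apply, twistedDerivative_apply, derivative_mul]
    linear_combination (twistedDerivative T L ^ s) q * hE

theorem pow_dvd_of_twistedDerivative {F : Type*} [Field F] (p : ℕ) [CharP F p] {T : F[X]} {x : F}
    (hT : T.eval x ≠ 0) (n : ℕ) (hn : n ≤ p) (R : F[X])
    (hR : ∀ s < n, ((twistedDerivative T 0 ^ s) R).eval x = 0) : (X - C x) ^ n ∣ R := by
  induction n generalizing R with
  | zero => simp
  | succ n ih =>
    obtain ⟨S, hS⟩ := ih (by omega) R fun s hs => hR s (by omega)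
    rcases Nat.eq_zero_or_pos n with rfl | hpos
    · rw [zero_add, pow_one, dvd_iff_isRoot]
      simpa using hR 0 (by omega)
    have h2 : (X - C x) ^ n ∣ T * derivative R := by
      have := ih (by omega) (twistedDerivative T 0 R) fun s hs => by
        rw [← Module.End.mul_apply, ← pow_succ]
        exact hR (s + 1) (by omega)
      simpa [twistedDerivative_apply] using this
    have hcop : IsCoprime ((X - C x) ^ n) T := by
      refine IsCoprime.pow_left ?_
      rw [(irreducible_X_sub_C x).coprime_iff_not_dvd, dvd_iff_isRoot]
      exact hT
    have h3 := hcop.dvd_of_dvd_mul_left h2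
    obtain ⟨m, rfl⟩ : ∃ m, n = m + 1 := ⟨n - 1, by omega⟩
    have hd : derivative R = (X - C x) ^ m * (C ((m + 1 : ℕ) : F) * S) +
        (X - C x) ^ (m + 1) * derivative S := by
      rw [hS, derivative_mul, derivative_X_sub_C_pow]
      simp
      ring
    rw [hd, dvd_add_left (dvd_mul_right _ _), pow_succ] at h3
    have h4 := (mul_dvd_mul_iff_left (pow_ne_zero m (X_sub_C_ne_zero x))).1 h3
    have hne : ((m + 1 : ℕ) : F) ≠ 0 := by
      rw [Ne, CharP.cast_eq_zero_iff F p]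
      exact fun h => by have := Nat.le_of_dvd (by omega) h; omega
    have h5 : X - C x ∣ S := by
      rw [dvd_iff_isRoot] at h4 ⊢
      push_cast at hne
      simpa [IsRoot, hne] using h4
    rw [hS, pow_succ (X - C x) (m + 1)]
    exact mul_dvd_mul_left _ h5

theorem mul_derivative_pow_eq {F : Type*} [Field F] {T L E : F[X]}
    (hE : T * derivative E = L * E) (n : ℕ) :
    T * derivative (E ^ n) = (n : F[X]) * L * E ^ n := by
  rw [derivative_pow]
  rcases n with _ | n
  · simp
  · simp only [Nat.add_sub_cancel, map_natCast]
    linear_combination (((n + 1 : ℕ) : F[X]) * E ^ n) * hE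

theorem mul_derivative_mul_eq {F : Type*} [Field F] {T L E L' E' : F[X]}
    (hE : T * derivative E = L * E) (hE' : T * derivative E' = L' * E') :
    T * derivative (E * E') = (L + L') * (E * E') := by
  rw [derivative_mul]
  linear_combination E' * hE + E * hE'

theorem linearIndependent_of_gap {F : Type*} [Field F] {m h : ℕ} {n : Fin m → ℕ}
    {W k : Fin m → F[X]} (hn : ∀ r r', r < r' → n r + h ≤ n r')
    (hW : ∀ r, (W r).eval 0 ≠ 0) (hk : ∀ r, (k r).degree < h)
    (hsum : ∑ r, k r * (X ^ n r * W r) = 0) : k = 0 := by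
  by_contra hne
  have hex : ∃ r, k r ≠ 0 := by
    by_contra hcon
    push Not at hcon
    exact hne (funext hcon)
  obtain ⟨r, hr, hmin⟩ : ∃ r, k r ≠ 0 ∧ ∀ r' < r, k r' = 0 := by
    classical
    obtain ⟨r, hr⟩ := (Finset.univ.filter fun r => k r ≠ 0).exists_minimal
      (by obtain ⟨r, hr⟩ := hex; exact ⟨r, by simpa using hr⟩)
    refine ⟨r, by simpa using hr.1, fun r' hr' => ?_⟩
    by_contra hc
    exact absurd (hr.2 (by simpa using hc) hr'.le) (not_le.2 hr')
  have hdvd : X ^ (n r + h) ∣ ∑ r' ∈ Finset.univ.erase r, k r' * (X ^ n r' * W r') := by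
    refine Finset.dvd_sum fun r' hr' => ?_
    rcases lt_trichotomy r' r with hlt | heq | hgt
    · rw [hmin r' hlt]; simp
    · exact absurd heq (Finset.ne_of_mem_erase hr')
    · exact Dvd.dvd.mul_left (Dvd.dvd.mul_right (pow_dvd_pow _ (hn _ _ hgt)) _) _
  rw [← Finset.add_sum_erase _ _ (Finset.mem_univ r)] at hsum
  have h1 : X ^ (n r + h) ∣ k r * (X ^ n r * W r) := by
    rw [eq_neg_of_add_eq_zero_left hsum]
    exact hdvd.neg_right
  have h2 : (X : F[X]) ^ h ∣ k r * W r := by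
    rw [pow_add, show k r * (X ^ n r * W r) = X ^ n r * (k r * W r) by ring] at h1
    exact (mul_dvd_mul_iff_left (pow_ne_zero _ X_ne_zero)).1 h1
  have hcop : IsCoprime ((X : F[X]) ^ h) (W r) := by
    refine IsCoprime.pow_left ?_
    rw [irreducible_X.coprime_iff_not_dvd, X_dvd_iff, coeff_zero_eq_eval_zero]
    exact hW r
  have h3 := hcop.dvd_of_dvd_mul_right h2
  refine hr (eq_zero_of_dvd_of_degree_lt h3 ?_)
  rw [degree_X_pow]
  exact hk r

/-- Siegel-type lemma over a field: the coefficients in an auxiliary polynomial can be chosen to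
satisfy any given linear vanishing conditions, if there are enough of them. -/
theorem exists_auxiliary {F : Type*} [Field F] {m h l M : ℕ} (hlt : l * M < m * h)
    (Φ : Fin l → Fin m → F[X] →ₗ[F] F[X]) :
    ∃ k : Fin m → F[X], k ≠ 0 ∧ (∀ r, (k r).degree < h) ∧
      ∀ s, ∀ t < M, (∑ r, Φ s r (k r)).coeff t = 0 := by
  let f : (Fin m → degreeLT F h) →ₗ[F] (Fin l × Fin M → F) :=
    LinearMap.pi fun st => lcoeff F st.2 ∘ₗ
      ∑ r, Φ st.1 r ∘ₗ (degreeLT F h).subtype ∘ₗ LinearMap.proj r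
  have hfin : Module.finrank F (degreeLT F h) = h := by
    rw [(degreeLTEquiv F h).finrank_eq]; simp
  have : Module.Finite F (degreeLT F h) := Module.Finite.equiv (degreeLTEquiv F h).symm
  have hker : LinearMap.ker f ≠ ⊥ := by
    apply LinearMap.ker_ne_bot_of_finrank_lt
    simpa [Module.finrank_pi_fintype, hfin] using hlt
  obtain ⟨k, hk, hk0⟩ := (Submodule.ne_bot_iff _).1 hker
  refine ⟨fun r => k r, fun h0 => hk0 ?_, fun r => mem_degreeLT.1 (k r).2, fun s t ht => ?_⟩
  · funext r
    exact Subtype.ext (congrFun h0 r)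
  · have := congrFun (LinearMap.mem_ker.1 hk) (s, ⟨t, ht⟩)
    simpa [f] using this

theorem card_mul_le_natDegree {F : Type*} [Field F] [DecidableEq F] {R : F[X]} (hR : R ≠ 0)
    {l : ℕ} (Z : Finset F) (hZ : ∀ x ∈ Z, (X - C x) ^ l ∣ R) : Z.card * l ≤ R.natDegree := by
  have h1 : ∏ x ∈ Z, (X - C x) ^ l ∣ R := by
    refine Finset.prod_dvd_of_coprime (fun x _ y _ hxy => ?_) hZ
    exact (pairwise_coprime_X_sub_C Function.injective_id hxy).pow
  have h2 := natDegree_le_of_dvd h1 hR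
  rw [natDegree_prod _ _ fun x _ => pow_ne_zero _ (X_sub_C_ne_zero x)] at h2
  simpa using h2

set_option maxHeartbeats 1000000 in
/-- Stepanov's method for the equation `(x (x + b) / ((x + c) (x + d))) ^ h = 1`, where
`h = (p - 1) / e`. -/
theorem stepanov_bound {p : ℕ} [Fact p.Prime] {b c d : ZMod p} (hb : b ≠ 0) (hc : c ≠ 0)
    (hd : d ≠ 0) {e h l K : ℕ} (heh : e * h = p - 1) (hl : l ≤ p)
    (hK : l * (h + 3 * l + K) < K * e * h) (Z : Finset (ZMod p))
    (hZ : ∀ x ∈ Z, x * (x + b) * ((x + c) * (x + d)) ≠ 0 ∧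
      (x * (x + b)) ^ h = ((x + c) * (x + d)) ^ h) : Z.card * l ≤ p * (K + 1) := by
  have hp : 2 ≤ p := (Fact.out : p.Prime).two_le
  have hh : 0 < h := by
    rcases Nat.eq_zero_or_pos h with rfl | h0
    · simp at hK
    · exact h0
  have he : 0 < e := by
    rcases Nat.eq_zero_or_pos e with rfl | h0
    · simp at hK
    · exact h0
  set U : (ZMod p)[X] := X + C b with hU
  set V : (ZMod p)[X] := (X + C c) * (X + C d) with hV
  set T : (ZMod p)[X] := X * U * V with hT
  have hUdeg : U.natDegree = 1 := natDegree_X_add_C b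
  have hVdeg : V.natDegree ≤ 2 := by
    rw [hV]
    refine natDegree_mul_le.trans ?_
    simp
  have hV'deg : (derivative V).natDegree ≤ 1 := (natDegree_derivative_le V).trans (by omega)
  have hTdeg : T.natDegree ≤ 4 := by
    have h1 := natDegree_mul_le (p := X * U) (q := V)
    have h2 := natDegree_mul_le (p := (X : (ZMod p)[X])) (q := U)
    rw [natDegree_X] at h2
    rw [← hT] at h1
    omega
  let n : Fin (K * e) → ℕ := fun r => h * (r % e) + p * (r / e)
  let W : Fin (K * e) → (ZMod p)[X] := fun r => U ^ (h * (r % e)) * V ^ (h * (e - 1 - r % e))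
  let L : Fin (K * e) → (ZMod p)[X] := fun r =>
    (n r : (ZMod p)[X]) * (U * V) + (((h * (r % e) : ℕ) : (ZMod p)[X]) * (X * V) +
      ((h * (e - 1 - r % e) : ℕ) : (ZMod p)[X]) * (X * U * derivative V))
  have hLdeg : ∀ r, (L r).natDegree ≤ 3 := by
    intro r
    have hnat : ∀ (m : ℕ) (q : (ZMod p)[X]), q.natDegree ≤ 3 →
        ((m : (ZMod p)[X]) * q).natDegree ≤ 3 := by
      intro m q hq
      refine natDegree_mul_le.trans ?_
      simpa using hq
    have h1 := natDegree_mul_le (p := U) (q := V)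
    have h2 := natDegree_mul_le (p := (X : (ZMod p)[X])) (q := V)
    have h3 := natDegree_mul_le (p := (X : (ZMod p)[X])) (q := U)
    have h4 := natDegree_mul_le (p := X * U) (q := derivative V)
    rw [natDegree_X] at h2 h3
    refine (natDegree_add_le _ _).trans (max_le (hnat _ _ (by omega)) ?_)
    exact (natDegree_add_le _ _).trans (max_le (hnat _ _ (by omega)) (hnat _ _ (by omega)))
  have hE : ∀ r, T * derivative (X ^ n r * W r) = L r * (X ^ n r * W r) := by
    intro r
    have hX : T * derivative (X : (ZMod p)[X]) = U * V * X := by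
      rw [derivative_X, hT]; ring
    have hU' : T * derivative U = X * V * U := by
      rw [hU, derivative_add, derivative_X, derivative_C, ← hU, hT]; ring
    have hV' : T * derivative V = X * U * derivative V * V := by
      rw [hT]; ring
    exact mul_derivative_mul_eq (mul_derivative_pow_eq hX _)
      (mul_derivative_mul_eq (mul_derivative_pow_eq hU' _) (mul_derivative_pow_eq hV' _))
  obtain ⟨k, hk0, hkdeg, hkcoeff⟩ := exists_auxiliary (F := ZMod p) (m := K * e) (h := h) (l := l)
    (M := h + 3 * l + K) hK
    (fun s r => LinearMap.mulLeft (ZMod p) (X ^ ((r : ℕ) / e)) ∘ₗ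
      (twistedDerivative T (L r) ^ (s : ℕ)))
  have hknat : ∀ r, (k r).natDegree ≤ h - 1 := by
    intro r
    by_cases h0 : k r = 0
    · simp [h0]
    · have := (natDegree_lt_iff_degree_lt h0).2 (hkdeg r)
      omega
  have hrK : ∀ r : Fin (K * e), (r : ℕ) / e ≤ K - 1 := by
    intro r
    have : (r : ℕ) / e < K := by
      rw [Nat.div_lt_iff_lt_mul he]; exact r.2
    omega
  have hcond : ∀ s : Fin l,
      ∑ r : Fin (K * e), X ^ ((r : ℕ) / e) * (twistedDerivative T (L r) ^ (s : ℕ)) (k r) = 0 := by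
    intro s
    have hdeg : (∑ r : Fin (K * e), X ^ ((r : ℕ) / e) *
        (twistedDerivative T (L r) ^ (s : ℕ)) (k r)).natDegree ≤ K - 1 + (h - 1 + 3 * s) := by
      refine natDegree_sum_le_of_forall_le _ _ fun r _ => ?_
      have h1 := natDegree_mul_le (p := (X : (ZMod p)[X]) ^ ((r : ℕ) / e))
        (q := (twistedDerivative T (L r) ^ (s : ℕ)) (k r))
      have h2 := natDegree_twistedDerivative_pow_le hTdeg (hLdeg r) (k r) s
      have h3 := hknat r
      have h4 := hrK r
      rw [natDegree_X_pow] at h1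
      omega
    ext t
    rw [coeff_zero]
    by_cases ht : t < h + 3 * l + K
    · simpa using hkcoeff s t ht
    · refine coeff_eq_zero_of_natDegree_lt (hdeg.trans_lt ?_)
      have := s.2
      omega
  set R : (ZMod p)[X] := ∑ r, k r * (X ^ n r * W r) with hR
  have hR0 : R ≠ 0 := by
    intro h0
    refine hk0 (linearIndependent_of_gap (h := h) (n := n) ?_ ?_ hkdeg h0)
    · intro r r' hrr'
      have hlt : (r : ℕ) < r' := hrr'
      have hn : ∀ r : Fin (K * e), n r = h * r + r / e := by
        intro r
        have hpe : p = e * h + 1 := by omega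
        change h * (r % e) + p * (r / e) = _
        conv_rhs => rw [← Nat.div_add_mod (r : ℕ) e]
        rw [hpe, Nat.mul_add_div he, Nat.div_eq_of_lt (Nat.mod_lt _ he)]
        ring
      rw [hn, hn]
      have h1 : (r : ℕ) / e ≤ r' / e := Nat.div_le_div_right hlt.le
      have h2 : h * (r + 1) ≤ h * r' := Nat.mul_le_mul_left _ hlt
      rw [mul_add] at h2
      omega
    · intro r
      simp [W, hU, hV, hb, hc, hd]
  have hRdeg : R.natDegree ≤ p * (K + 1) := by
    refine natDegree_sum_le_of_forall_le _ _ fun r _ => ?_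
    have hK0 : 0 < K := by
      rcases Nat.eq_zero_or_pos K with rfl | h0
      · simp at hK
      · exact h0
    have h1 := natDegree_mul_le (p := k r) (q := X ^ n r * W r)
    have h2 := natDegree_mul_le (p := (X : (ZMod p)[X]) ^ n r) (q := W r)
    have h3 := natDegree_mul_le (p := U ^ (h * (r % e))) (q := V ^ (h * (e - 1 - r % e)))
    have h4 := natDegree_pow_le_of_le (h * (r % e)) hUdeg.le
    have h5 := natDegree_pow_le_of_le (h * (e - 1 - r % e)) hVdeg
    rw [natDegree_X_pow] at h2
    have h6 := hknat r
    have h7 : p * (r / e) ≤ p * (K - 1) := Nat.mul_le_mul_left _ (hrK r)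
    have h8 : (r : ℕ) % e < e := Nat.mod_lt _ he
    have h9 : h * (r % e) + h * (e - 1 - r % e) + h = p - 1 := by
      rw [← mul_add, ← Nat.mul_succ, ← heh, mul_comm e]
      congr 1
      omega
    have h10 : p * (K + 1) = p * (K - 1) + 2 * p := by
      obtain ⟨K', rfl⟩ : ∃ K', K = K' + 1 := ⟨K - 1, by omega⟩
      simp; ring
    have h11 : n r = h * (r % e) + p * (r / e) := rfl
    have h12 : (W r).natDegree = (U ^ (h * (r % e)) * V ^ (h * (e - 1 - r % e))).natDegree := rfl
    omega
  refine (card_mul_le_natDegree hR0 Z fun x hx => ?_).trans hRdeg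
  obtain ⟨hx0, hxh⟩ := hZ x hx
  have hTx : T.eval x ≠ 0 := by
    simpa [hT, hU, hV] using hx0
  refine pow_dvd_of_twistedDerivative p hTx l hl R fun s hs => ?_
  rw [hR, map_sum]
  simp_rw [fun r => twistedDerivative_zero_pow_mul (hE r) (k r) s]
  have hEx : ∀ r : Fin (K * e), (X ^ n r * W r).eval x =
      V.eval x ^ (h * (e - 1)) * (X ^ ((r : ℕ) / e) : (ZMod p)[X]).eval x := by
    intro r
    have h8 : (r : ℕ) % e < e := Nat.mod_lt _ he
    have hUV : (x * U.eval x) ^ h = V.eval x ^ h := by simpa [hU, hV] using hxh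
    have hsplit : h * (e - 1) = h * (r % e) + h * (e - 1 - r % e) := by
      rw [← mul_add]; congr 1; omega
    have h11 : n r = h * (r % e) + p * (r / e) := rfl
    simp only [W, eval_mul, eval_pow, eval_X]
    rw [h11, hsplit, pow_add, pow_add, pow_mul x p, ZMod.pow_card, pow_mul (eval x V) h (r % e),
      ← hUV]
    ring
  rw [eval_finsetSum]
  have h0 := congrArg (eval x) (hcond ⟨s, hs⟩)
  rw [eval_finsetSum, eval_zero] at h0
  calc _ = V.eval x ^ (h * (e - 1)) * ∑ r : Fin (K * e),
        (X ^ ((r : ℕ) / e) * (twistedDerivative T (L r) ^ s) (k r)).eval x := by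
        rw [Finset.mul_sum]
        refine Finset.sum_congr rfl fun r _ => ?_
        rw [eval_mul, hEx, eval_mul (p := (X ^ ((r : ℕ) / e) : (ZMod p)[X]))]
        ring
    _ = 0 := by rw [h0, mul_zero]

end

theorem mul_card_le_of_stepanov {p : ℕ} [Fact p.Prime] (hp : 10000 ≤ p) {b c d : ZMod p}
    (hb : b ≠ 0) (hc : c ≠ 0) (hd : d ≠ 0) {e h : ℕ} (heh : e * h = p - 1) (Z : Finset (ZMod p))
    (hZ : ∀ x ∈ Z, x * (x + b) * ((x + c) * (x + d)) ≠ 0 ∧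
      (x * (x + b)) ^ h = ((x + c) * (x + d)) ^ h) :
    (e : ℝ) * Z.card ≤ p + 9 * e * √p := by
  set l := Nat.sqrt p with hl
  have hl1 : l * l ≤ p := Nat.sqrt_le p
  have hl2 : p < (l + 1) * (l + 1) := Nat.lt_succ_sqrt p
  have hl3 : 100 ≤ l := Nat.le_sqrt.2 (by omega)
  have he : 0 < e := by
    rcases Nat.eq_zero_or_pos e with rfl | h0
    · omega
    · exact h0
  have hle : l / e ≤ l := Nat.div_le_self _ _
  have hle' : l / e * e ≤ l := Nat.div_mul_le_self _ _
  have hK : l * (h + 3 * l + (l / e + 7)) < (l / e + 7) * e * h := by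
    have h1 : l ≤ (l / e + 1) * e := ((Nat.div_lt_iff_lt_mul he).1 (Nat.lt_succ_self _)).le
    have h2 : (l + 6 * e) * h ≤ (l / e + 7) * e * h := by
      refine Nat.mul_le_mul_right _ ?_
      nlinarith
    have h3 : (l + 6 * e) * h = l * h + 6 * (p - 1) := by rw [← heh]; ring
    have h4 : l * (l / e) ≤ l * l := Nat.mul_le_mul_left _ hle
    have h5 : 100 * l ≤ l * l := Nat.mul_le_mul_right _ hl3
    have h6 : l * (h + 3 * l + (l / e + 7)) = l * h + 3 * (l * l) + l * (l / e) + 7 * l := by ring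
    omega
  have hmain := stepanov_bound hb hc hd heh (l := l) (by nlinarith) hK Z hZ
  have h1 : Z.card * l * e ≤ p * (l + 8 * e) := by
    calc Z.card * l * e ≤ p * (l / e + 7 + 1) * e := Nat.mul_le_mul_right _ hmain
      _ = p * (l / e * e + 8 * e) := by ring
      _ ≤ _ := by gcongr
  have h2 : (Z.card : ℝ) * l * e ≤ p * (l + 8 * e) := by exact_mod_cast h1
  have hs : √(p : ℝ) * √p = p := Real.mul_self_sqrt (by positivity)
  have hs1 : √(p : ℝ) ≤ l + 1 := by
    rw [Real.sqrt_le_left (by positivity), pow_two]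
    exact_mod_cast hl2.le
  have hl4 : (100 : ℝ) ≤ l := by exact_mod_cast hl3
  have hpl : 8 * (p : ℝ) ≤ 9 * √p * l := by
    nlinarith [Real.sqrt_nonneg (p : ℝ)]
  have h3 : ((e : ℝ) * Z.card) * l ≤ (p + 9 * e * √p) * l := by
    have he' : (0 : ℝ) < e := by exact_mod_cast he
    nlinarith
  exact le_of_mul_le_mul_right h3 (by linarith)

/-- Upper bound for the number of `x` such that a ratio of products of linear factors, one of
which is different from the three others, is an `e`-th power. -/
theorem mul_card_filter_le {p : ℕ} [Fact p.Prime] (hp : 10000 ≤ p) {b₁ b₂ b₃ b₄ : ZMod p}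
    (hb : (b₁ ≠ b₂ ∧ b₁ ≠ b₃ ∧ b₁ ≠ b₄) ∨ (b₂ ≠ b₁ ∧ b₂ ≠ b₃ ∧ b₂ ≠ b₄) ∨
      (b₃ ≠ b₁ ∧ b₃ ≠ b₂ ∧ b₃ ≠ b₄) ∨ (b₄ ≠ b₁ ∧ b₄ ≠ b₂ ∧ b₄ ≠ b₃))
    {e h : ℕ} (heh : e * h = p - 1) (Z : Finset (ZMod p))
    (hZ : ∀ x ∈ Z, (x + b₁) * (x + b₂) * ((x + b₃) * (x + b₄)) ≠ 0 ∧
      ((x + b₁) * (x + b₂)) ^ h = ((x + b₃) * (x + b₄)) ^ h) :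
    (e : ℝ) * Z.card ≤ p + 9 * e * √p := by
  have key : ∀ c₁ c₂ c₃ c₄ : ZMod p, c₁ ≠ c₂ → c₁ ≠ c₃ → c₁ ≠ c₄ →
      (∀ x ∈ Z, (x + c₁) * (x + c₂) * ((x + c₃) * (x + c₄)) ≠ 0 ∧
        ((x + c₁) * (x + c₂)) ^ h = ((x + c₃) * (x + c₄)) ^ h) →
      (e : ℝ) * Z.card ≤ p + 9 * e * √p := by
    intro c₁ c₂ c₃ c₄ h2 h3 h4 hc
    rw [← Finset.card_map (addRightEmbedding c₁)]
    refine mul_card_le_of_stepanov hp (sub_ne_zero.2 h2.symm) (sub_ne_zero.2 h3.symm)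
      (sub_ne_zero.2 h4.symm) heh _ fun y hy => ?_
    obtain ⟨x, hx, rfl⟩ := Finset.mem_map.1 hy
    simpa [add_assoc] using hc x hx
  rcases hb with ⟨h1, h2, h3⟩ | ⟨h1, h2, h3⟩ | ⟨h1, h2, h3⟩ | ⟨h1, h2, h3⟩
  · exact key b₁ b₂ b₃ b₄ h1 h2 h3 hZ
  · refine key b₂ b₁ b₃ b₄ h1 h2 h3 fun x hx => ?_
    rw [mul_comm (x + b₂)]
    exact hZ x hx
  · refine key b₃ b₄ b₁ b₂ h3 h1 h2 fun x hx => ?_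
    exact ⟨by rw [mul_comm]; exact (hZ x hx).1, (hZ x hx).2.symm⟩
  · refine key b₄ b₃ b₁ b₂ h3 h1 h2 fun x hx => ?_
    rw [mul_comm (x + b₄)]
    exact ⟨by rw [mul_comm]; exact (hZ x hx).1, (hZ x hx).2.symm⟩

section

open Finset

theorem exists_mulChar_eq_one_iff {p : ℕ} [Fact p.Prime] {ℓ : ℕ} (hℓ : ℓ ∣ p - 1) :
    ∃ χ : MulChar (ZMod p) ℂ, χ ^ ℓ = 1 ∧
      ∀ y : ZMod p, y ≠ 0 → (χ y = 1 ↔ y ^ ((p - 1) / ℓ) = 1) := by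
  have hp1 : 0 < p - 1 := by have := (Fact.out : p.Prime).two_le; omega
  have hℓ0 : ℓ ≠ 0 := by rintro rfl; rw [zero_dvd_iff] at hℓ; omega
  obtain ⟨χ, hχ⟩ := MulChar.exists_mulChar_orderOf (ZMod p) (n := ℓ) (by rwa [ZMod.card])
    (Complex.isPrimitiveRoot_exp ℓ hℓ0)
  refine ⟨χ, by rw [← hχ]; exact pow_orderOf_eq_one χ, fun y hy => ?_⟩
  obtain ⟨g, hg⟩ := IsCyclic.exists_monoid_generator (α := (ZMod p)ˣ)
  have hgord : orderOf g = p - 1 := by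
    rw [orderOf_eq_card_of_forall_mem_powers hg, Nat.card_eq_fintype_card, ZMod.card_units]
  have hχg : orderOf (χ g) = ℓ := by
    rw [← hχ]
    refine orderOf_eq_orderOf_iff.2 fun n => ?_
    constructor
    · intro h
      ext u
      obtain ⟨i, rfl⟩ := Submonoid.mem_powers_iff _ _ |>.1 (hg u)
      rw [MulChar.pow_apply_coe, MulChar.one_apply_coe, Units.val_pow_eq_pow_val, map_pow,
        ← pow_mul, mul_comm, pow_mul, h, one_pow]
    · intro h
      rw [← MulChar.pow_apply_coe, h, MulChar.one_apply_coe]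
  obtain ⟨i, hi⟩ := Submonoid.mem_powers_iff _ _ |>.1 (hg (Units.mk0 y hy))
  have hyi : y = (g : ZMod p) ^ i := by
    rw [← Units.val_pow_eq_pow_val, hi, Units.val_mk0]
  rw [hyi, map_pow, ← orderOf_dvd_iff_pow_eq_one, hχg, ← pow_mul, ← orderOf_dvd_iff_pow_eq_one,
    orderOf_units, hgord]
  conv_rhs => rw [← Nat.mul_div_cancel' hℓ, mul_comm, mul_comm i]
  rw [Nat.mul_div_cancel _ (Nat.pos_of_ne_zero hℓ0), mul_dvd_mul_iff_left]
  exact (Nat.div_pos (Nat.le_of_dvd hp1 hℓ) (Nat.pos_of_ne_zero hℓ0)).ne'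

theorem MulChar.prod_apply_of_ne_zero {F ι : Type*} [Field F] (s : Finset ι) (χ : ι → MulChar F ℂ)
    {y : F} (hy : y ≠ 0) : (∏ i ∈ s, χ i) y = ∏ i ∈ s, χ i y := by
  classical
  induction s using Finset.induction_on with
  | empty => simp [MulChar.one_apply hy.isUnit]
  | insert a s ha ih => rw [prod_insert ha, prod_insert ha, MulChar.mul_apply, ih]

theorem sum_range_ite_mul_pow {ℓ : ℕ} (hℓ : 0 < ℓ) (v z : ℂ) (hz : z ^ ℓ = 1) :
    ∑ j ∈ range ℓ, (if j = 0 then 1 else v) * z ^ j =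
      1 + v * ((if z = 1 then (ℓ : ℂ) else 0) - 1) := by
  have h1 : ∑ j ∈ range ℓ, z ^ j = if z = 1 then (ℓ : ℂ) else 0 := by
    split_ifs with h
    · simp [h]
    · rw [geom_sum_eq h, hz, sub_self, zero_div]
  rw [← h1]
  obtain ⟨m, rfl⟩ : ∃ m, ℓ = m + 1 := ⟨ℓ - 1, by omega⟩
  rw [sum_range_succ', sum_range_succ' (fun j => z ^ j)]
  simp [mul_sum]
  ring

theorem pow_div_prod_primes_eq_one_iff {G : Type*} [Group G] {n : ℕ} {y : G}
    (hy : y ^ n = 1) {S : Finset ℕ} (hS : S ⊆ n.primeFactors) :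
    y ^ (n / ∏ ℓ ∈ S, ℓ) = 1 ↔ ∀ ℓ ∈ S, y ^ (n / ℓ) = 1 := by
  have hdvd : ∀ d, d ∣ n → (y ^ (n / d) = 1 ↔ d ∣ n / orderOf y) := by
    intro d hd
    have ho : orderOf y ∣ n := orderOf_dvd_of_pow_eq_one hy
    rw [← orderOf_dvd_iff_pow_eq_one, Nat.dvd_div_iff_mul_dvd hd, Nat.dvd_div_iff_mul_dvd ho,
      mul_comm]
  have hprime : ∀ ℓ ∈ S, Prime ℓ := fun ℓ hℓ => (Nat.prime_of_mem_primeFactors (hS hℓ)).prime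
  have hprod : ∏ ℓ ∈ S, ℓ ∣ n :=
    prod_primes_dvd _ hprime fun ℓ hℓ => Nat.dvd_of_mem_primeFactors (hS hℓ)
  rw [hdvd _ hprod]
  constructor
  · intro h ℓ hℓ
    rw [hdvd _ (Nat.dvd_of_mem_primeFactors (hS hℓ))]
    exact (dvd_prod_of_mem _ hℓ).trans h
  · intro h
    refine prod_primes_dvd _ hprime fun ℓ hℓ => ?_
    rw [← hdvd _ (Nat.dvd_of_mem_primeFactors (hS hℓ))]
    exact h ℓ hℓ

/-- A weighted family of characters whose weighted sum vanishes on all residues that are not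
primitive roots, together with the sum for the absolute values of the weights. -/
theorem exists_weighted_characters (p : ℕ) [Fact p.Prime] :
    ∃ (J : Finset ((p - 1).primeFactors → ℕ)) (χ : ((p - 1).primeFactors → ℕ) → MulChar (ZMod p) ℂ)
      (u : ((p - 1).primeFactors → ℕ) → ℝ) (c : Finset ℕ → ℝ),
      0 ∈ J ∧ χ 0 = 1 ∧ u 0 = 1 ∧ ∑ j ∈ J, |u j| = 2 ^ (p - 1).primeFactors.card ∧
      (∀ y : ZMod p, y ≠ 0 → orderOf y ≠ p - 1 → ∑ j ∈ J, (u j : ℂ) * χ j y = 0) ∧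
      (∀ S ∈ (p - 1).primeFactors.powerset, 0 ≤ c S) ∧
      ∑ S ∈ (p - 1).primeFactors.powerset, c S = 1 ∧
      ∑ S ∈ (p - 1).primeFactors.powerset, c S * ((∏ ℓ ∈ S, ℓ : ℕ) : ℝ) =
        2 ^ (p - 1).primeFactors.card ∧
      ∀ y : ZMod p, y ≠ 0 → ∑ j ∈ J, ((|u j| : ℝ) : ℂ) * χ j y =
        ((∑ S ∈ (p - 1).primeFactors.powerset, c S *
          if y ^ ((p - 1) / ∏ ℓ ∈ S, ℓ) = 1 then ((∏ ℓ ∈ S, ℓ : ℕ) : ℝ) else 0 : ℝ) : ℂ) := by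
  classical
  have hp1 : 0 < p - 1 := by have := (Fact.out : p.Prime).two_le; omega
  have hP : ∀ ℓ ∈ (p - 1).primeFactors, 2 ≤ ℓ := fun ℓ hℓ =>
    (Nat.prime_of_mem_primeFactors hℓ).two_le
  have hPR : ∀ ℓ ∈ (p - 1).primeFactors, (2 : ℝ) ≤ ℓ := fun ℓ hℓ => by exact_mod_cast hP ℓ hℓ
  set P := (p - 1).primeFactors with hPdef
  have hex : ∀ ℓ : P, ∃ χ : MulChar (ZMod p) ℂ, χ ^ (ℓ : ℕ) = 1 ∧
      ∀ y : ZMod p, y ≠ 0 → (χ y = 1 ↔ y ^ ((p - 1) / ℓ) = 1) := fun ℓ =>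
    exists_mulChar_eq_one_iff (Nat.dvd_of_mem_primeFactors ℓ.2)
  choose χ hχ hχy using hex
  have hz : ∀ (ℓ : P) (y : ZMod p), y ≠ 0 → χ ℓ y ^ (ℓ : ℕ) = 1 := by
    intro ℓ y hy
    rw [← MulChar.pow_apply' _ (by have := hP ℓ ℓ.2; omega), hχ, MulChar.one_apply hy.isUnit]
  let J : Finset (P → ℕ) := Fintype.piFinset fun ℓ : P => range ℓ
  let loc : ℝ → P → ℕ → ℝ := fun ε ℓ j => if j = 0 then 1 else ε * (1 / ((ℓ : ℝ) - 1))
  have hfactor : ∀ (ε : ℝ) (y : ZMod p), y ≠ 0 →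
      ∑ j ∈ J, ((∏ ℓ, loc ε ℓ (j ℓ) : ℝ) : ℂ) * (∏ ℓ, χ ℓ ^ j ℓ) y =
      ∏ ℓ : P, (1 + (ε * (1 / ((ℓ : ℂ) - 1))) *
        ((if y ^ ((p - 1) / ℓ) = 1 then (ℓ : ℂ) else 0) - 1)) := by
    intro ε y hy
    have h1 : ∀ ℓ : P, (1 + (ε * (1 / ((ℓ : ℂ) - 1))) *
        ((if y ^ ((p - 1) / ℓ) = 1 then (ℓ : ℂ) else 0) - 1)) =
        ∑ j ∈ range ℓ, ((loc ε ℓ j : ℝ) : ℂ) * χ ℓ y ^ j := by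
      intro ℓ
      have := sum_range_ite_mul_pow (by have := hP ℓ ℓ.2; omega) (ε * (1 / ((ℓ : ℂ) - 1)))
        (χ ℓ y) (hz ℓ y hy)
      simp only [hχy ℓ y hy] at this
      rw [← this]
      refine sum_congr rfl fun j _ => ?_
      by_cases hj : j = 0 <;> simp [loc, hj]
    simp_rw [h1]
    rw [prod_univ_sum]
    refine sum_congr rfl fun j _ => ?_
    rw [MulChar.prod_apply_of_ne_zero _ _ hy, Complex.ofReal_prod, ← prod_mul_distrib]
    refine prod_congr rfl fun ℓ _ => ?_
    congr 1
    by_cases hj : j ℓ = 0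
    · simp [hj, MulChar.one_apply hy.isUnit]
    · rw [MulChar.pow_apply' _ hj]
  have habs : ∀ j : P → ℕ, |∏ ℓ, loc (-1) ℓ (j ℓ)| = ∏ ℓ, loc 1 ℓ (j ℓ) := by
    intro j
    rw [abs_prod]
    refine prod_congr rfl fun ℓ _ => ?_
    have := hPR ℓ ℓ.2
    by_cases hj : j ℓ = 0
    · simp [loc, hj]
    · simp only [loc, hj, if_false]
      rw [abs_mul, abs_neg, abs_one, abs_of_nonneg (by apply one_div_nonneg.2; linarith)]
  let c : Finset ℕ → ℝ := fun S => (∏ ℓ ∈ S, (1 / ((ℓ : ℝ) - 1))) *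
    ∏ ℓ ∈ P \ S, (((ℓ : ℝ) - 2) / ((ℓ : ℝ) - 1))
  refine ⟨J, fun j => ∏ ℓ, χ ℓ ^ j ℓ, fun j => ∏ ℓ, loc (-1) ℓ (j ℓ), c, ?_, ?_, ?_, ?_, ?_, ?_,
    ?_, ?_, ?_⟩
  · rw [Fintype.mem_piFinset]
    intro ℓ
    have := hP ℓ ℓ.2
    simp; omega
  · simp
  · simp [loc]
  · simp_rw [habs]
    have h1 := hfactor 1 1 one_ne_zero
    simp only [map_one, mul_one, one_pow, if_true] at h1
    have h2 : ∀ ℓ : P, (1 + (((1 : ℝ) : ℂ) * (1 / ((ℓ : ℂ) - 1))) * ((ℓ : ℂ) - 1)) = 2 := by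
      intro ℓ
      have : ((ℓ : ℂ) - 1) ≠ 0 := by
        rw [sub_ne_zero]
        have := hP ℓ ℓ.2
        exact_mod_cast (by omega : (ℓ : ℕ) ≠ 1)
      field_simp
      norm_num
    simp_rw [h2] at h1
    rw [prod_const, card_univ, Fintype.card_coe] at h1
    exact_mod_cast h1
  · intro y hy hord
    rw [hfactor (-1) y hy]
    obtain ⟨ℓ, hℓ, hyℓ⟩ : ∃ ℓ : ℕ, ∃ _ : ℓ ∈ P, y ^ ((p - 1) / ℓ) = 1 := by
      by_contra hcon
      push Not at hcon
      refine hord (orderOf_eq_of_pow_and_pow_div_prime hp1 (ZMod.pow_card_sub_one_eq_one hy)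
        fun q hq hqd => hcon q (Nat.mem_primeFactors.2 ⟨hq, hqd, hp1.ne'⟩))
    refine prod_eq_zero (mem_univ ⟨ℓ, hℓ⟩) ?_
    have : ((ℓ : ℂ) - 1) ≠ 0 := by
      rw [sub_ne_zero]
      have := hP ℓ hℓ
      exact_mod_cast (by omega : (ℓ : ℕ) ≠ 1)
    simp only [hyℓ, if_true]
    field_simp
    push_cast
    ring
  · intro S hS
    rw [mem_powerset] at hS
    refine mul_nonneg (prod_nonneg fun ℓ hℓ => ?_) (prod_nonneg fun ℓ hℓ => ?_)
    · have := hPR ℓ (hS hℓ)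
      apply one_div_nonneg.2; linarith
    · have := hPR ℓ (mem_sdiff.1 hℓ).1
      exact div_nonneg (by linarith) (by linarith)
  · rw [← prod_add]
    refine prod_eq_one fun ℓ hℓ => ?_
    have := hPR ℓ hℓ
    have : (ℓ : ℝ) - 1 ≠ 0 := by linarith
    field_simp
    ring
  · have h1 : ∏ ℓ ∈ P, (1 / ((ℓ : ℝ) - 1) * ℓ + ((ℓ : ℝ) - 2) / ((ℓ : ℝ) - 1)) = 2 ^ P.card := by
      rw [← prod_const]
      refine prod_congr rfl fun ℓ hℓ => ?_
      have := hPR ℓ hℓ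
      have : (ℓ : ℝ) - 1 ≠ 0 := by linarith
      field_simp
      ring
    rw [← h1, prod_add]
    refine sum_congr rfl fun S _ => ?_
    simp only [c]
    rw [prod_mul_distrib, Nat.cast_prod]
    ring
  · intro y hy
    simp_rw [habs]
    rw [hfactor 1 y hy]
    have h1 : ∀ ℓ : P, (1 + (((1 : ℝ) : ℂ) * (1 / ((ℓ : ℂ) - 1))) *
        ((if y ^ ((p - 1) / ℓ) = 1 then (ℓ : ℂ) else 0) - 1)) =
        (((1 / (((ℓ : ℕ) : ℝ) - 1) * (if y ^ ((p - 1) / (ℓ : ℕ)) = 1 then ((ℓ : ℕ) : ℝ) else 0) +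
          (((ℓ : ℕ) : ℝ) - 2) / (((ℓ : ℕ) : ℝ) - 1) : ℝ)) : ℂ) := by
      intro ℓ
      have : ((ℓ : ℂ) - 1) ≠ 0 := by
        rw [sub_ne_zero]
        have := hP ℓ ℓ.2
        exact_mod_cast (by omega : (ℓ : ℕ) ≠ 1)
      split_ifs <;> push_cast <;> field_simp <;> ring
    simp_rw [h1]
    rw [← Complex.ofReal_prod, prod_coe_sort P fun ℓ : ℕ => (1 / ((ℓ : ℝ) - 1) *
      (if y ^ ((p - 1) / ℓ) = 1 then (ℓ : ℝ) else 0) + ((ℓ : ℝ) - 2) / ((ℓ : ℝ) - 1)), prod_add]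
    congr 1
    refine sum_congr rfl fun S hS => ?_
    rw [mem_powerset] at hS
    simp only [c]
    rw [prod_mul_distrib]
    have h2 : (∏ ℓ ∈ S, if y ^ ((p - 1) / ℓ) = 1 then (ℓ : ℝ) else 0) =
        if y ^ ((p - 1) / ∏ ℓ ∈ S, ℓ) = 1 then ((∏ ℓ ∈ S, ℓ : ℕ) : ℝ) else 0 := by
      have hu := pow_div_prod_primes_eq_one_iff (y := Units.mk0 y hy)
        (ZMod.units_pow_card_sub_one_eq_one p _) hS
      simp only [Units.ext_iff, Units.val_pow_eq_pow_val, Units.val_mk0, Units.val_one] at hu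
      rw [Finset.prod_ite_zero, Nat.cast_prod]
      simp only [hu]
    rw [h2]
    ring

theorem card_mul_eq_mul_le (A N : ℕ) :
    ((((Icc 1 A ×ˢ Icc 1 N) ×ˢ (Icc 1 A ×ˢ Icc 1 N)).filter
      fun q => q.1.1 * q.2.2 = q.2.1 * q.1.2).card : ℝ) ≤ 2 * A * N * (1 + Real.log A) := by
  let f₁ : ℕ → ℕ × ℕ × ℕ → (ℕ × ℕ) × ℕ × ℕ := fun n r =>
    ((r.2.1 * r.1, r.2.2 * r.1), (r.2.1 * n, r.2.2 * n))
  let f₂ : ℕ → ℕ × ℕ × ℕ → (ℕ × ℕ) × ℕ × ℕ := fun n r =>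
    ((r.2.1 * n, r.2.2 * n), (r.2.1 * r.1, r.2.2 * r.1))
  let I : ℕ → Finset (ℕ × ℕ × ℕ) := fun n => Icc 1 n ×ˢ Icc 1 (A / n) ×ˢ Icc 1 (N / n)
  have hsub : (((Icc 1 A ×ˢ Icc 1 N) ×ˢ (Icc 1 A ×ˢ Icc 1 N)).filter
      fun q => q.1.1 * q.2.2 = q.2.1 * q.1.2) ⊆
      (Icc 1 A).biUnion fun n => (I n).image (f₁ n) ∪ (I n).image (f₂ n) := by
    rintro ⟨⟨a₁, m₁⟩, a₂, m₂⟩ hq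
    simp only [mem_filter, mem_product, mem_Icc] at hq
    obtain ⟨⟨⟨⟨ha₁, ha₁'⟩, hm₁, hm₁'⟩, ⟨ha₂, ha₂'⟩, hm₂, hm₂'⟩, heq⟩ := hq
    obtain ⟨g, α₁, α₂, hg, hcop, rfl, rfl⟩ := Nat.exists_coprime' (m := a₁) (n := a₂)
      (Nat.gcd_pos_of_pos_left _ ha₁)
    have heq' : α₁ * m₂ = α₂ * m₁ := by
      apply Nat.eq_of_mul_eq_mul_right hg
      linarith
    obtain ⟨t, rfl⟩ : α₁ ∣ m₁ := hcop.dvd_of_dvd_mul_left ⟨m₂, heq'.symm⟩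
    have hα₁ : 0 < α₁ := by
      rcases Nat.eq_zero_or_pos α₁ with rfl | h0
      · simp at ha₁
      · exact h0
    have hα₂ : 0 < α₂ := by
      rcases Nat.eq_zero_or_pos α₂ with rfl | h0
      · simp at ha₂
      · exact h0
    have ht : 0 < t := by
      rcases Nat.eq_zero_or_pos t with rfl | h0
      · simp at hm₁
      · exact h0
    obtain rfl : m₂ = α₂ * t := by
      apply Nat.eq_of_mul_eq_mul_left hα₁
      rw [heq']; ring
    simp only [mem_biUnion, mem_union, mem_image, mem_Icc, I, f₁, f₂, mem_product, Prod.mk.injEq,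
      Prod.exists]
    rcases le_total α₁ α₂ with h | h
    · refine ⟨α₂, ⟨hα₂, (Nat.le_mul_of_pos_right _ hg).trans ha₂'⟩, Or.inl ⟨α₁, g, t,
        ⟨⟨hα₁, h⟩, ⟨hg, ?_⟩, ht, ?_⟩, ⟨mul_comm _ _, mul_comm _ _⟩, mul_comm _ _, mul_comm _ _⟩⟩
      · rw [Nat.le_div_iff_mul_le hα₂]; linarith
      · rw [Nat.le_div_iff_mul_le hα₂]; linarith
    · refine ⟨α₁, ⟨hα₁, (Nat.le_mul_of_pos_right _ hg).trans ha₁'⟩, Or.inr ⟨α₂, g, t,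
        ⟨⟨hα₂, h⟩, ⟨hg, ?_⟩, ht, ?_⟩, ⟨mul_comm _ _, mul_comm _ _⟩, mul_comm _ _, mul_comm _ _⟩⟩
      · rw [Nat.le_div_iff_mul_le hα₁]; linarith
      · rw [Nat.le_div_iff_mul_le hα₁]; linarith
  have h1 := (card_le_card hsub).trans card_biUnion_le
  have h2 : ∀ n ∈ Icc 1 A, (((I n).image (f₁ n) ∪ (I n).image (f₂ n)).card : ℝ) ≤
      2 * A * N * ((n : ℝ)⁻¹) := by
    intro n hn
    have hn0 : (0 : ℝ) < n := by exact_mod_cast (mem_Icc.1 hn).1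
    have h3 : ((I n).image (f₁ n) ∪ (I n).image (f₂ n)).card ≤ 2 * (n * (A / n * (N / n))) := by
      refine (card_union_le _ _).trans ?_
      have h4 : (I n).card = n * (A / n * (N / n)) := by simp [I]
      have h5 := card_image_le (s := I n) (f := f₁ n)
      have h6 := card_image_le (s := I n) (f := f₂ n)
      omega
    calc (((I n).image (f₁ n) ∪ (I n).image (f₂ n)).card : ℝ)
        ≤ ((2 * (n * (A / n * (N / n))) : ℕ) : ℝ) := by exact_mod_cast h3
      _ = 2 * (n * (((A / n : ℕ) : ℝ) * ((N / n : ℕ) : ℝ))) := by push_cast; ring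
      _ ≤ 2 * (n * (((A : ℝ) / n) * ((N : ℝ) / n))) := by
          gcongr <;> exact Nat.cast_div_le
      _ = _ := by field_simp
  calc _ ≤ ((∑ n ∈ Icc 1 A, ((I n).image (f₁ n) ∪ (I n).image (f₂ n)).card : ℕ) : ℝ) := by
        exact_mod_cast h1
    _ ≤ ∑ n ∈ Icc 1 A, 2 * A * N * ((n : ℝ)⁻¹) := by
        push_cast
        exact sum_le_sum h2
    _ = 2 * A * N * (harmonic A : ℝ) := by
        rw [← mul_sum, harmonic_eq_sum_Icc]
        push_cast
        rfl
    _ ≤ _ := by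
        gcongr
        exact harmonic_le_one_add_log A

theorem sum_mul_mul_pow_four_le {ι : Type*} (s : Finset ι) (w v g : ι → ℝ)
    (hw : ∀ i ∈ s, 0 ≤ w i) (hv : ∀ i ∈ s, 0 ≤ v i) :
    (∑ i ∈ s, w i * v i * g i) ^ 4 ≤
      (∑ i ∈ s, w i * v i) ^ 2 * ((∑ i ∈ s, w i * v i ^ 2) * ∑ i ∈ s, w i * g i ^ 4) := by
  have h1 : (∑ i ∈ s, w i * v i * g i) ^ 2 ≤
      (∑ i ∈ s, w i * v i) * ∑ i ∈ s, w i * v i * g i ^ 2 :=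
    sum_sq_le_sum_mul_sum_of_sq_le_mul s (fun i hi => mul_nonneg (hw i hi) (hv i hi))
      (fun i hi => mul_nonneg (mul_nonneg (hw i hi) (hv i hi)) (sq_nonneg _))
      fun i _ => le_of_eq (by ring)
  have h2 : (∑ i ∈ s, w i * v i * g i ^ 2) ^ 2 ≤
      (∑ i ∈ s, w i * v i ^ 2) * ∑ i ∈ s, w i * g i ^ 4 :=
    sum_sq_le_sum_mul_sum_of_sq_le_mul s (fun i hi => mul_nonneg (hw i hi) (sq_nonneg _))
      (fun i hi => mul_nonneg (hw i hi) (by positivity)) fun i _ => le_of_eq (by ring)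
  calc (∑ i ∈ s, w i * v i * g i) ^ 4 = ((∑ i ∈ s, w i * v i * g i) ^ 2) ^ 2 := by ring
    _ ≤ ((∑ i ∈ s, w i * v i) * ∑ i ∈ s, w i * v i * g i ^ 2) ^ 2 :=
        pow_le_pow_left₀ (sq_nonneg _) h1 2
    _ = (∑ i ∈ s, w i * v i) ^ 2 * (∑ i ∈ s, w i * v i * g i ^ 2) ^ 2 := by ring
    _ ≤ _ := mul_le_mul_of_nonneg_left h2 (sq_nonneg _)

/-- The pairs `(a, m)` with `1 ≤ a ≤ A`, `1 ≤ m ≤ N` and `m / a = x` modulo `p`. -/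
def ratioFiber (p : ℕ) [Fact p.Prime] (A N : ℕ) (x : ZMod p) : Finset (ℕ × ℕ) :=
  (Icc 1 A ×ˢ Icc 1 N).filter fun q => (q.2 : ZMod p) / (q.1 : ZMod p) = x

theorem sum_card_ratioFiber_mul (p : ℕ) [Fact p.Prime] (A N : ℕ) (f : ZMod p → ℝ) :
    ∑ x, ((ratioFiber p A N x).card : ℝ) * f x =
      ∑ q ∈ Icc 1 A ×ˢ Icc 1 N, f ((q.2 : ZMod p) / (q.1 : ZMod p)) := by
  rw [← sum_fiberwise (Icc 1 A ×ˢ Icc 1 N) fun q => (q.2 : ZMod p) / (q.1 : ZMod p)]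
  refine sum_congr rfl fun x _ => ?_
  rw [← nsmul_eq_mul, ← sum_const]
  refine sum_congr rfl fun q hq => ?_
  rw [(mem_filter.1 hq).2]

theorem sum_card_ratioFiber_sq_le (p : ℕ) [Fact p.Prime] {A N : ℕ} (h : A * N < p) :
    ∑ x, ((ratioFiber p A N x).card : ℝ) ^ 2 ≤ 2 * A * N * (1 + Real.log A) := by
  refine le_trans ?_ (card_mul_eq_mul_le A N)
  have h1 : ∑ x, (ratioFiber p A N x ×ˢ ratioFiber p A N x).card ≤
      (((Icc 1 A ×ˢ Icc 1 N) ×ˢ (Icc 1 A ×ˢ Icc 1 N)).filter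
      fun q => q.1.1 * q.2.2 = q.2.1 * q.1.2).card := by
    rw [← card_biUnion]
    · refine card_le_card fun q hq => ?_
      obtain ⟨⟨a₁, m₁⟩, a₂, m₂⟩ := q
      simp only [mem_biUnion, mem_univ, true_and, mem_product, ratioFiber, mem_filter] at hq
      obtain ⟨x, ⟨hq1, hx1⟩, hq2, hx2⟩ := hq
      simp only [mem_filter, mem_product]
      refine ⟨⟨hq1, hq2⟩, ?_⟩
      simp only [mem_Icc] at hq1 hq2
      obtain ⟨⟨ha₁, ha₁'⟩, hm₁, hm₁'⟩ := hq1
      obtain ⟨⟨ha₂, ha₂'⟩, hm₂, hm₂'⟩ := hq2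
      have hAp : A < p := (Nat.le_mul_of_pos_right A (by omega)).trans_lt h
      have hne : ∀ a, 1 ≤ a → a ≤ A → (a : ZMod p) ≠ 0 := by
        intro a h1 h2 h0
        rw [ZMod.natCast_eq_zero_iff] at h0
        have := Nat.le_of_dvd (by omega) h0
        omega
      rw [← hx2, div_eq_div_iff (hne _ ha₁ ha₁') (hne _ ha₂ ha₂')] at hx1
      have hx3 : ((a₁ * m₂ : ℕ) : ZMod p) = ((a₂ * m₁ : ℕ) : ZMod p) := by
        push_cast
        rw [mul_comm, ← hx1, mul_comm]
      rw [ZMod.natCast_eq_natCast_iff', Nat.mod_eq_of_lt, Nat.mod_eq_of_lt] at hx3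
      · exact hx3
      · exact (Nat.mul_le_mul ha₂' hm₁').trans_lt h
      · exact (Nat.mul_le_mul ha₁' hm₂').trans_lt h
    · intro x _ y _ hxy
      rw [Function.onFun, disjoint_left]
      intro q hq hq'
      simp only [mem_product, ratioFiber, mem_filter] at hq hq'
      exact hxy (hq.1.2.symm.trans hq'.1.2)
  calc ∑ x, ((ratioFiber p A N x).card : ℝ) ^ 2 =
      ((∑ x, (ratioFiber p A N x ×ˢ ratioFiber p A N x).card : ℕ) : ℝ) := by
        push_cast
        exact sum_congr rfl fun x _ => by rw [card_product]; push_cast; ring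
    _ ≤ _ := by exact_mod_cast h1

/-- The ratio `(x + b₁) (x + b₂) / ((x + b₃) (x + b₄))`. -/
def crossRatio (p : ℕ) [Fact p.Prime] (q : (ℕ × ℕ) × ℕ × ℕ) (x : ZMod p) : ZMod p :=
  (x + q.1.1) * (x + q.1.2) * ((x + q.2.1)⁻¹ * (x + q.2.2)⁻¹)

theorem norm_sum_pow_four_eq {p : ℕ} [Fact p.Prime] (χ : MulChar (ZMod p) ℂ) (s : Finset ℕ)
    (x : ZMod p) :
    ‖∑ b ∈ s, χ (x + b)‖ ^ 4 = ∑ q ∈ (s ×ˢ s) ×ˢ (s ×ˢ s), (χ (crossRatio p q x)).re := by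
  have h1 : ((‖∑ b ∈ s, χ (x + b)‖ ^ 4 : ℝ) : ℂ) =
      ∑ q ∈ (s ×ˢ s) ×ˢ (s ×ˢ s), χ (crossRatio p q x) := by
    set z := ∑ b ∈ s, χ (x + b) with hz
    have hconj : (starRingEnd ℂ) z = ∑ b ∈ s, χ ((x + b)⁻¹) := by
      rw [hz, map_sum]
      refine sum_congr rfl fun b _ => ?_
      rw [← MulChar.inv_apply']
      exact MulChar.star_apply' χ (x + b)
    have h2 : ((‖z‖ ^ 4 : ℝ) : ℂ) = (z * z) * ((starRingEnd ℂ) z * (starRingEnd ℂ) z) := by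
      have := Complex.mul_conj' z
      push_cast
      linear_combination (-(‖z‖ : ℂ) ^ 2 - z * (starRingEnd ℂ) z) * this
    rw [h2, hconj, hz, sum_mul_sum, sum_mul_sum, ← sum_product', ← sum_product', sum_mul_sum,
      ← sum_product']
    refine sum_congr rfl fun q _ => ?_
    simp only [crossRatio, map_mul]
  rw [← Complex.ofReal_re (‖∑ b ∈ s, χ (x + b)‖ ^ 4), h1, Complex.re_sum]

/-- Quadruples that match up in pairs. -/
def IsPaired (q : (ℕ × ℕ) × ℕ × ℕ) : Prop :=
  (q.1.1 = q.1.2 ∧ q.2.1 = q.2.2) ∨ (q.1.1 = q.2.1 ∧ q.1.2 = q.2.2) ∨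
    (q.1.1 = q.2.2 ∧ q.1.2 = q.2.1)

instance : DecidablePred IsPaired := fun _ => inferInstanceAs (Decidable (_ ∨ _))

theorem card_isPaired_le (s : Finset ℕ) :
    (((s ×ˢ s) ×ˢ (s ×ˢ s)).filter IsPaired).card ≤ 3 * s.card ^ 2 := by
  have hsub : ((s ×ˢ s) ×ˢ (s ×ˢ s)).filter IsPaired ⊆
      (s ×ˢ s).image (fun r => ((r.1, r.1), (r.2, r.2))) ∪
      ((s ×ˢ s).image (fun r => ((r.1, r.2), (r.1, r.2))) ∪
      (s ×ˢ s).image (fun r => ((r.1, r.2), (r.2, r.1)))) := by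
    rintro ⟨⟨b₁, b₂⟩, b₃, b₄⟩ hq
    simp only [mem_filter, mem_product, IsPaired] at hq
    simp only [mem_union, mem_image, mem_product, Prod.exists, Prod.mk.injEq]
    obtain ⟨⟨⟨h1, h2⟩, h3, h4⟩, ⟨rfl, rfl⟩ | ⟨rfl, rfl⟩ | ⟨rfl, rfl⟩⟩ := hq
    · exact Or.inl ⟨_, _, ⟨h1, h3⟩, by simp⟩
    · exact Or.inr (Or.inl ⟨_, _, ⟨h1, h2⟩, by simp⟩)
    · exact Or.inr (Or.inr ⟨_, _, ⟨h1, h2⟩, by simp⟩)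
  refine (card_le_card hsub).trans ?_
  refine (card_union_le _ _).trans ?_
  have h0 := card_union_le ((s ×ˢ s).image (fun r => ((r.1, r.2), (r.1, r.2))))
    ((s ×ˢ s).image (fun r => ((r.1, r.2), (r.2, r.1))))
  have h1 := card_image_le (s := s ×ˢ s) (f := fun r => ((r.1, r.1), (r.2, r.2)))
  have h2 := card_image_le (s := s ×ˢ s) (f := fun r => ((r.1, r.2), (r.1, r.2)))
  have h3 := card_image_le (s := s ×ˢ s) (f := fun r => ((r.1, r.2), (r.2, r.1)))
  have h4 : (s ×ˢ s).card = s.card ^ 2 := by rw [card_product, sq]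
  omega

theorem mul_card_crossRatio_le {p : ℕ} [Fact p.Prime] (hp : 10000 ≤ p) {q : (ℕ × ℕ) × ℕ × ℕ}
    (hq : ¬ IsPaired q) (h₁ : q.1.1 < p) (h₂ : q.1.2 < p) (h₃ : q.2.1 < p) (h₄ : q.2.2 < p)
    {e : ℕ} (he : e ∣ p - 1) :
    (e : ℝ) * (univ.filter fun x : ZMod p => crossRatio p q x ≠ 0 ∧
      crossRatio p q x ^ ((p - 1) / e) = 1).card ≤ p + 9 * e * √p := by
  obtain ⟨⟨b₁, b₂⟩, b₃, b₄⟩ := q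
  dsimp only at h₁ h₂ h₃ h₄
  have hinj : ∀ b b' : ℕ, b < p → b' < p → ((b : ZMod p) = b' ↔ b = b') := by
    intro b b' hb hb'
    rw [ZMod.natCast_eq_natCast_iff', Nat.mod_eq_of_lt hb, Nat.mod_eq_of_lt hb']
  refine mul_card_filter_le hp (b₁ := b₁) (b₂ := b₂) (b₃ := b₃) (b₄ := b₄) ?_
    (Nat.mul_div_cancel' he) _ ?_
  · simp only [ne_eq, hinj, h₁, h₂, h₃, h₄]
    simp only [IsPaired] at hq
    grind
  · intro x hx
    obtain ⟨hx0, hx1⟩ := (mem_filter.1 hx).2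
    simp only [crossRatio] at hx0 hx1
    rw [← mul_inv] at hx0 hx1
    have hV : (x + b₃) * (x + b₄) ≠ 0 := fun h0 => hx0 (by rw [h0]; simp)
    have hU : (x + b₁) * (x + b₂) ≠ 0 := fun h0 => hx0 (by rw [h0]; simp)
    refine ⟨mul_ne_zero hU hV, ?_⟩
    rw [mul_pow, inv_pow] at hx1
    exact eq_of_mul_inv_eq_one hx1

theorem sub_four_le_card_crossRatio_ne_zero {p : ℕ} [Fact p.Prime] (q : (ℕ × ℕ) × ℕ × ℕ) :
    (p : ℝ) - 4 ≤ (univ.filter fun x : ZMod p => crossRatio p q x ≠ 0).card := by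
  have h1 : (univ.filter fun x : ZMod p => ¬ crossRatio p q x ≠ 0) ⊆
      {-(q.1.1 : ZMod p), -(q.1.2 : ZMod p), -(q.2.1 : ZMod p), -(q.2.2 : ZMod p)} := by
    intro x hx
    simp only [mem_filter, mem_univ, true_and, crossRatio, not_not, mul_eq_zero, inv_eq_zero,
      add_eq_zero_iff_eq_neg] at hx
    simp only [mem_insert, mem_singleton]
    tauto
  have h2 := (card_le_card h1).trans card_le_four
  have h3 := card_filter_add_card_filter_not (s := (univ : Finset (ZMod p)))
    (fun x => crossRatio p q x ≠ 0)
  rw [card_univ, ZMod.card] at h3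
  have h4 : p ≤ (univ.filter fun x : ZMod p => crossRatio p q x ≠ 0).card + 4 := by omega
  have h5 : (p : ℝ) ≤ (univ.filter fun x : ZMod p => crossRatio p q x ≠ 0).card + 4 := by
    exact_mod_cast h4
  linarith

theorem weighted_fourth_moment_le {p : ℕ} [Fact p.Prime] (hp : 10000 ≤ p) {ι κ : Type*}
    (J : Finset ι) (χ : ι → MulChar (ZMod p) ℂ) (w : ι → ℝ) (hw : ∀ j ∈ J, 0 ≤ w j)
    (D : Finset κ) (c : κ → ℝ) (e : κ → ℕ) (hc : ∀ S ∈ D, 0 ≤ c S) (hc1 : ∑ S ∈ D, c S = 1)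
    (he : ∀ S ∈ D, e S ∣ p - 1)
    (hsum : ∀ y : ZMod p, y ≠ 0 → ∑ j ∈ J, w j * (χ j y).re =
      ∑ S ∈ D, c S * (if y ^ ((p - 1) / e S) = 1 then (e S : ℝ) else 0) - 1)
    {B : ℕ} (hB : B < p) :
    ∑ j ∈ J, w j * ∑ x, ‖∑ b ∈ Icc 1 B, χ j (x + b)‖ ^ 4 ≤
      (∑ j ∈ J, w j) * (3 * B ^ 2 * p) + B ^ 4 * (9 * √p * ∑ S ∈ D, c S * e S + 4) := by
  set s := Icc 1 B with hs
  have hscard : s.card = B := by simp [s]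
  have hc0 : 0 ≤ ∑ S ∈ D, c S * e S := sum_nonneg fun S hS => mul_nonneg (hc S hS) (by positivity)
  have hw0 : 0 ≤ ∑ j ∈ J, w j := sum_nonneg hw
  let H : (ℕ × ℕ) × ℕ × ℕ → ℝ := fun q => ∑ x, ∑ j ∈ J, w j * (χ j (crossRatio p q x)).re
  have h1 : ∑ j ∈ J, w j * ∑ x, ‖∑ b ∈ s, χ j (x + b)‖ ^ 4 =
      ∑ q ∈ (s ×ˢ s) ×ˢ (s ×ˢ s), H q := by
    simp_rw [norm_sum_pow_four_eq, mul_sum, H]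
    rw [sum_congr rfl fun j _ => sum_comm, sum_comm]
    rw [sum_congr rfl fun x _ => sum_comm, sum_comm]
  have hpaired : ∀ q, H q ≤ (∑ j ∈ J, w j) * p := by
    intro q
    calc H q ≤ ∑ _x : ZMod p, ∑ j ∈ J, w j := by
          refine sum_le_sum fun x _ => sum_le_sum fun j hj => ?_
          refine mul_le_of_le_one_right (hw j hj) ?_
          exact (Complex.re_le_norm _).trans (DirichletCharacter.norm_le_one _ _)
      _ = _ := by rw [sum_const, card_univ, ZMod.card, nsmul_eq_mul, mul_comm]
  have hgeneric : ∀ q ∈ (s ×ˢ s) ×ˢ (s ×ˢ s), ¬ IsPaired q →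
      H q ≤ 9 * √p * ∑ S ∈ D, c S * e S + 4 := by
    intro q hq hqp
    have hlt : ∀ b ∈ s, b < p := fun b hb => (mem_Icc.1 hb).2.trans_lt hB
    simp only [mem_product] at hq
    set X := univ.filter fun x : ZMod p => crossRatio p q x ≠ 0 with hX
    have h2 : H q = ∑ x ∈ X, (∑ S ∈ D, c S *
        (if crossRatio p q x ^ ((p - 1) / e S) = 1 then (e S : ℝ) else 0) - 1) := by
      rw [hX, sum_filter]
      refine sum_congr rfl fun x _ => ?_
      split_ifs with h
      · exact hsum _ h
      · rw [not_not] at h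
        simp [h, MulChar.map_zero]
    have h3 : H q = ∑ S ∈ D, c S * (e S * ((univ.filter fun x : ZMod p => crossRatio p q x ≠ 0 ∧
        crossRatio p q x ^ ((p - 1) / e S) = 1).card : ℝ)) - X.card := by
      rw [h2, sum_sub_distrib, sum_comm]
      congr 1
      · refine sum_congr rfl fun S _ => ?_
        rw [← mul_sum, ← sum_filter, hX, filter_filter, sum_const, nsmul_eq_mul, mul_comm (e S : ℝ)]
      · simp
    have h4 : ∑ S ∈ D, c S * (e S * ((univ.filter fun x : ZMod p => crossRatio p q x ≠ 0 ∧
        crossRatio p q x ^ ((p - 1) / e S) = 1).card : ℝ)) ≤ ∑ S ∈ D, c S * (p + 9 * e S * √p) :=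
      sum_le_sum fun S hS => mul_le_mul_of_nonneg_left
        (mul_card_crossRatio_le hp hqp (hlt _ hq.1.1) (hlt _ hq.1.2) (hlt _ hq.2.1)
          (hlt _ hq.2.2) (he S hS)) (hc S hS)
    have h5 : ∑ S ∈ D, c S * (p + 9 * e S * √p) = p + 9 * √p * ∑ S ∈ D, c S * e S := by
      calc _ = (∑ S ∈ D, c S) * p + 9 * √p * ∑ S ∈ D, c S * e S := by
            rw [sum_mul, mul_sum, ← sum_add_distrib]
            exact sum_congr rfl fun S _ => by ring
        _ = _ := by rw [hc1, one_mul]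
    have h6 := sub_four_le_card_crossRatio_ne_zero (p := p) q
    rw [← hX] at h6
    linarith
  rw [h1, ← sum_filter_add_sum_filter_not _ IsPaired]
  refine add_le_add ?_ ?_
  · calc _ ≤ ∑ _q ∈ ((s ×ˢ s) ×ˢ (s ×ˢ s)).filter IsPaired, (∑ j ∈ J, w j) * p :=
          sum_le_sum fun q _ => hpaired q
      _ ≤ ((3 * B ^ 2 : ℕ) : ℝ) * ((∑ j ∈ J, w j) * p) := by
          rw [sum_const, nsmul_eq_mul]
          refine mul_le_mul_of_nonneg_right ?_ (by positivity)
          have := card_isPaired_le s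
          rw [hscard] at this
          exact_mod_cast this
      _ = _ := by push_cast; ring
  · calc _ ≤ ∑ _q ∈ ((s ×ˢ s) ×ˢ (s ×ˢ s)).filter fun q => ¬ IsPaired q,
            (9 * √p * ∑ S ∈ D, c S * e S + 4) :=
          sum_le_sum fun q hq => hgeneric q (mem_filter.1 hq).1 (mem_filter.1 hq).2
      _ ≤ ((B ^ 4 : ℕ) : ℝ) * (9 * √p * ∑ S ∈ D, c S * e S + 4) := by
          rw [sum_const, nsmul_eq_mul]
          refine mul_le_mul_of_nonneg_right ?_ (by positivity)
          have h2 : ((s ×ˢ s) ×ˢ (s ×ˢ s)).card = B ^ 4 := by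
            simp only [card_product, hscard]; ring
          have := card_filter_le ((s ×ˢ s) ×ˢ (s ×ˢ s)) fun q => ¬ IsPaired q
          rw [h2] at this
          exact_mod_cast this
      _ = _ := by push_cast; ring

theorem norm_sum_mulChar_add_mul_le {p : ℕ} [Fact p.Prime] (χ : MulChar (ZMod p) ℂ) {a : ZMod p}
    (ha : a ≠ 0) (m : ZMod p) (s : Finset ℕ) :
    ‖∑ b ∈ s, χ (m + a * b)‖ ≤ ‖∑ b ∈ s, χ (m / a + b)‖ := by
  have h : ∑ b ∈ s, χ (m + a * b) = χ a * ∑ b ∈ s, χ (m / a + b) := by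
    rw [mul_sum]
    refine sum_congr rfl fun b _ => ?_
    rw [← map_mul, mul_add, mul_div_cancel₀ _ ha]
  rw [h, norm_mul]
  exact mul_le_of_le_one_left (norm_nonneg _) (DirichletCharacter.norm_le_one _ _)

theorem mul_pow_four_le_of_forall_orderOf_ne {p : ℕ} [Fact p.Prime] (hp : 10000 ≤ p)
    {A B N : ℕ} (hA : 0 < A) (hB : 0 < B) (hN : 0 < N) (hAN : A * N < p)
    (h : ∀ n : ℕ, 0 < n → n ≤ N + A * B → n < p ∧ orderOf (n : ZMod p) ≠ p - 1) :
    (N * A * B ^ 4 : ℝ) ≤ 2 * (2 ^ (p - 1).primeFactors.card - 1) ^ 4 * (1 + Real.log A) *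
      (3 * B ^ 2 * p + B ^ 4 * (18 * √p + 4)) := by
  obtain ⟨J, χ, u, c, h0J, hχ0, hu0, husum, hvan, hc, hc1, hcsum, hchar⟩ :=
    exists_weighted_characters p
  set R : ℝ := 2 ^ (p - 1).primeFactors.card - 1 with hRdef
  have hne : ∀ n : ℕ, 0 < n → n < p → (n : ZMod p) ≠ 0 := by
    intro n h1 h2 h0
    rw [ZMod.natCast_eq_zero_iff] at h0
    exact absurd (Nat.le_of_dvd h1 h0) (by omega)
  have hR : ∑ j ∈ J.erase 0, |u j| = R := by
    have := add_sum_erase J (fun j => |u j|) h0J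
    simp only [hu0, abs_one] at this
    rw [hRdef]; linarith
  have hR1 : 1 ≤ R := by
    have h1 : (p - 1).primeFactors.card ≠ 0 := by
      rw [card_ne_zero, Nat.nonempty_primeFactors]; omega
    have h2 : (2 : ℝ) ^ 1 ≤ 2 ^ (p - 1).primeFactors.card :=
      pow_le_pow_right₀ (by norm_num) (by omega)
    rw [hRdef]; linarith
  have hpoint : ∀ y : ZMod p, y ≠ 0 → orderOf y ≠ p - 1 →
      ∑ j ∈ J.erase 0, (u j : ℂ) * χ j y = -1 := by
    intro y hy hy'
    have h1 := hvan y hy hy'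
    rw [← add_sum_erase J _ h0J, hu0, hχ0, MulChar.one_apply (isUnit_iff_ne_zero.2 hy)] at h1
    push_cast at h1
    linear_combination h1
  have hre : ∀ y : ZMod p, y ≠ 0 → ∑ j ∈ J.erase 0, |u j| * (χ j y).re =
      ∑ S ∈ (p - 1).primeFactors.powerset, c S *
        (if y ^ ((p - 1) / ∏ ℓ ∈ S, ℓ) = 1 then ((∏ ℓ ∈ S, ℓ : ℕ) : ℝ) else 0) - 1 := by
    intro y hy
    have h1 := congrArg Complex.re (hchar y hy)
    rw [Complex.ofReal_re, ← add_sum_erase J _ h0J, hu0, hχ0,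
      MulChar.one_apply (isUnit_iff_ne_zero.2 hy), Complex.add_re, Complex.re_sum] at h1
    simp only [Complex.re_ofReal_mul, abs_one, Complex.ofReal_re, mul_one] at h1
    linarith
  set v : ZMod p → ℝ := fun x => ((ratioFiber p A N x).card : ℝ) with hv
  let g : (((p - 1).primeFactors → ℕ) × ZMod p) → ℝ := fun i =>
    ‖∑ b ∈ Icc 1 B, χ i.1 (i.2 + b)‖
  have hcount : (N * A * B : ℝ) ≤ ∑ i ∈ J.erase 0 ×ˢ univ, |u i.1| * v i.2 * g i := by
    have h1 : ∑ q ∈ Icc 1 A ×ˢ Icc 1 N, ∑ b ∈ Icc 1 B, ∑ j ∈ J.erase 0,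
        (u j : ℂ) * χ j ((q.2 : ZMod p) + q.1 * b) = -((N * A * B : ℝ) : ℂ) := by
      have : ∀ q ∈ Icc 1 A ×ˢ Icc 1 N, ∀ b ∈ Icc 1 B, ∑ j ∈ J.erase 0,
          (u j : ℂ) * χ j ((q.2 : ZMod p) + q.1 * b) = -1 := by
        intro q hq b hb
        simp only [mem_product, mem_Icc] at hq hb
        have h2 := h (q.2 + q.1 * b) (by omega)
          (add_le_add hq.2.2 (Nat.mul_le_mul hq.1.2 hb.2))
        have h3 := hne (q.2 + q.1 * b) (by omega) h2.1
        have h4 := hpoint _ h3 h2.2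
        push_cast at h4
        exact h4
      rw [sum_congr rfl fun q hq => sum_congr rfl fun b hb => this q hq b hb]
      simp only [sum_const, card_product, Nat.card_Icc, add_tsub_cancel_right, nsmul_eq_mul]
      push_cast
      ring
    have h2 : ∑ q ∈ Icc 1 A ×ˢ Icc 1 N, ∑ b ∈ Icc 1 B, ∑ j ∈ J.erase 0,
        (u j : ℂ) * χ j ((q.2 : ZMod p) + q.1 * b) =
        ∑ j ∈ J.erase 0, (u j : ℂ) * ∑ q ∈ Icc 1 A ×ˢ Icc 1 N, ∑ b ∈ Icc 1 B,
          χ j ((q.2 : ZMod p) + q.1 * b) := by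
      simp_rw [mul_sum]
      rw [sum_congr rfl fun q _ => sum_comm, sum_comm]
    have h3 : (N * A * B : ℝ) = ‖∑ j ∈ J.erase 0, (u j : ℂ) * ∑ q ∈ Icc 1 A ×ˢ Icc 1 N,
        ∑ b ∈ Icc 1 B, χ j ((q.2 : ZMod p) + q.1 * b)‖ := by
      rw [← h2, h1, norm_neg, Complex.norm_real, Real.norm_of_nonneg (by positivity)]
    rw [h3]
    refine (norm_sum_le _ _).trans ?_
    rw [sum_product]
    refine sum_le_sum fun j _ => ?_
    rw [norm_mul, Complex.norm_real, Real.norm_eq_abs]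
    simp_rw [mul_assoc]
    rw [← mul_sum, sum_card_ratioFiber_mul p A N fun x => g (j, x)]
    refine mul_le_mul_of_nonneg_left ((norm_sum_le _ _).trans (sum_le_sum fun q hq => ?_))
      (abs_nonneg _)
    simp only [mem_product, mem_Icc] at hq
    refine norm_sum_mulChar_add_mul_le (χ j) (hne q.1 hq.1.1 ?_) _ _
    exact lt_of_le_of_lt (hq.1.2.trans (Nat.le_mul_of_pos_right A hN)) hAN
  have hholder := sum_mul_mul_pow_four_le (J.erase 0 ×ˢ (univ : Finset (ZMod p)))
    (fun i => |u i.1|) (fun i => v i.2) g (fun _ _ => abs_nonneg _) (fun _ _ => Nat.cast_nonneg _)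
  have hsum1 : ∑ i ∈ J.erase 0 ×ˢ (univ : Finset (ZMod p)), |u i.1| * v i.2 = R * (N * A) := by
    rw [sum_product, ← hR, sum_mul]
    refine sum_congr rfl fun j _ => ?_
    have h1 := sum_card_ratioFiber_mul p A N fun _ => 1
    simp only [mul_one, sum_const, card_product, Nat.card_Icc, add_tsub_cancel_right,
      nsmul_eq_mul] at h1
    dsimp only
    rw [← mul_sum, hv, h1]
    push_cast
    ring
  have hsum2 : ∑ i ∈ J.erase 0 ×ˢ (univ : Finset (ZMod p)), |u i.1| * v i.2 ^ 2 ≤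
      R * (2 * A * N * (1 + Real.log A)) := by
    rw [sum_product, ← hR, sum_mul]
    refine sum_le_sum fun j _ => ?_
    dsimp only
    rw [← mul_sum]
    exact mul_le_mul_of_nonneg_left (sum_card_ratioFiber_sq_le p hAN) (abs_nonneg _)
  have hsum3 : ∑ i ∈ J.erase 0 ×ˢ (univ : Finset (ZMod p)), |u i.1| * g i ^ 4 ≤
      R * (3 * B ^ 2 * p + B ^ 4 * (18 * √p + 4)) := by
    have hBp : B < p := (h B hB (by nlinarith)).1
    have hdvd : ∀ S ∈ (p - 1).primeFactors.powerset, ∏ ℓ ∈ S, ℓ ∣ p - 1 := by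
      intro S hS
      refine Finset.prod_primes_dvd _ (fun ℓ hℓ => ?_) (fun ℓ hℓ => ?_)
      · exact (Nat.prime_of_mem_primeFactors (mem_powerset.1 hS hℓ)).prime
      · exact Nat.dvd_of_mem_primeFactors (mem_powerset.1 hS hℓ)
    have h1 := weighted_fourth_moment_le hp (J.erase 0) χ (fun j => |u j|)
      (fun _ _ => abs_nonneg _) (p - 1).primeFactors.powerset c (fun S => ∏ ℓ ∈ S, ℓ) hc hc1 hdvd
      hre hBp
    rw [hR, hcsum] at h1
    rw [sum_product]
    simp_rw [← mul_sum]
    refine h1.trans ?_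
    have h2 : (2 : ℝ) ^ (p - 1).primeFactors.card ≤ 2 * R := by rw [hRdef] at hR1 ⊢; linarith
    have h3 : 9 * √p * 2 ^ (p - 1).primeFactors.card + 4 ≤ R * (18 * √p + 4) := by
      nlinarith [mul_le_mul_of_nonneg_left h2 (Real.sqrt_nonneg p)]
    have h4 := mul_le_mul_of_nonneg_left h3 (show (0 : ℝ) ≤ B ^ 4 by positivity)
    linarith
  have hlog : 0 ≤ Real.log A := Real.log_natCast_nonneg A
  have hR0 : 0 ≤ R := by linarith
  have hAR : (0 : ℝ) < A := by exact_mod_cast hA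
  have hNR : (0 : ℝ) < N := by exact_mod_cast hN
  have hfin : ((N * A * B : ℝ)) ^ 4 ≤ (R * (N * A)) ^ 2 * ((R * (2 * A * N * (1 + Real.log A))) *
      (R * (3 * B ^ 2 * p + B ^ 4 * (18 * √p + 4)))) := by
    refine (pow_le_pow_left₀ (by positivity) hcount 4).trans (hholder.trans ?_)
    rw [hsum1]
    refine mul_le_mul_of_nonneg_left ?_ (sq_nonneg _)
    exact mul_le_mul hsum2 hsum3
      (sum_nonneg fun i _ => mul_nonneg (abs_nonneg _) (by positivity)) (by positivity)
  refine le_of_mul_le_mul_left ?_ (show (0 : ℝ) < (N * A) ^ 3 by positivity)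
  calc _ = ((N * A * B : ℝ)) ^ 4 := by ring
    _ ≤ _ := hfin
    _ = _ := by ring


theorem not_mul_pow_four_le_of_large {K P L R : ℝ} (hK : 50000 ≤ K) (hP0 : 0 ≤ P)
    (hP : P ≤ 16 * (K + 1) ^ 4) (hL : 1 + Real.log (2 * K) ≤ L / 2)
    (hR : 163 * (R ^ 4 * L) ≤ 2 * (K + 1)) :
    ¬ (2 * K ^ 2 - 3) * (2 * K) * K ^ 4 ≤ 2 * R ^ 4 * (1 + Real.log (2 * K)) *
      (3 * K ^ 2 * P + K ^ 4 * (18 * √P + 4)) := by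
  intro h
  have hK1 : K + 1 ≤ 1.001 * K := by linarith
  have hK0 : 0 < K := by linarith
  have hs : √P ≤ 4 * (K + 1) ^ 2 := by
    rw [Real.sqrt_le_left (by positivity)]
    linarith
  have h2 : (K + 1) ^ 2 ≤ 1.01 * K ^ 2 := by
    have := pow_le_pow_left₀ (by linarith) hK1 2
    nlinarith [sq_nonneg K]
  have h4 : (K + 1) ^ 4 ≤ 1.03 * K ^ 4 := by
    have := pow_le_pow_left₀ (by positivity) h2 2
    nlinarith [pow_pos hK0 4]
  have h5 : 3 * K ^ 2 * P + K ^ 4 * (18 * √P + 4) ≤ 150 * K ^ 6 := by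
    have e1 : K ^ 2 * P ≤ K ^ 2 * (16 * (1.03 * K ^ 4)) :=
      mul_le_mul_of_nonneg_left (by linarith) (by positivity)
    have e2 : K ^ 4 * (18 * √P + 4) ≤ K ^ 4 * (80 * K ^ 2) :=
      mul_le_mul_of_nonneg_left (by nlinarith) (by positivity)
    nlinarith [pow_pos hK0 6]
  have h6 : 2 * R ^ 4 * (1 + Real.log (2 * K)) ≤ 2.002 * K / 163 := by
    have := mul_le_mul_of_nonneg_left hL (show 0 ≤ 2 * R ^ 4 by positivity)
    linarith
  have h7 : 2 * R ^ 4 * (1 + Real.log (2 * K)) * (3 * K ^ 2 * P + K ^ 4 * (18 * √P + 4)) ≤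
      2.002 * K / 163 * (150 * K ^ 6) :=
    mul_le_mul h6 h5 (by positivity) (by positivity)
  have h8 : 1.9 * K ^ 2 * (2 * K) * K ^ 4 ≤ (2 * K ^ 2 - 3) * (2 * K) * K ^ 4 := by
    gcongr
    nlinarith
  nlinarith [pow_pos hK0 7]

theorem exists_nat_fourth_power_bounds {P : ℝ} (hP : 10 ^ 20 ≤ P) :
    ∃ k : ℕ, 50000 ≤ k ∧ 16 * (k : ℝ) ^ 4 ≤ P ∧ P ≤ 16 * (k + 1 : ℝ) ^ 4 ∧
      P ^ ((1 : ℝ) / 4) ≤ 2 * (k + 1) := by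
  have hP0 : (0 : ℝ) ≤ P := le_trans (by positivity) hP
  set x : ℝ := P ^ ((1 : ℝ) / 4) with hx
  have hx0 : 0 ≤ x := Real.rpow_nonneg hP0 _
  have hx4 : x ^ 4 = P := by
    rw [hx, ← Real.rpow_natCast, ← Real.rpow_mul hP0]
    norm_num
  have hx5 : 10 ^ 5 ≤ x := by
    refine le_of_pow_le_pow_left₀ (n := 4) (by norm_num) hx0 ?_
    rw [hx4]
    linarith
  have hk1 : (⌊x / 2⌋₊ : ℝ) ≤ x / 2 := Nat.floor_le (by positivity)
  have hk2 : x / 2 < ⌊x / 2⌋₊ + 1 := Nat.lt_floor_add_one _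
  refine ⟨⌊x / 2⌋₊, Nat.le_floor (by push_cast; linarith), ?_, ?_, by linarith⟩
  · calc 16 * (⌊x / 2⌋₊ : ℝ) ^ 4 ≤ 16 * (x / 2) ^ 4 := by gcongr
      _ = P := by rw [← hx4]; ring
  · calc P = 16 * (x / 2) ^ 4 := by rw [← hx4]; ring
      _ ≤ _ := by gcongr

theorem mul_pow_four_mul_log_le_of_criterion {P P₀ R : ℝ} (hP₀ : 10 ^ 20 ≤ P₀) (hP : P₀ < P)
    (hR : 0 ≤ R)
    (hcrit : 3.5751 * (1 - 2 / P₀ ^ ((1 : ℝ) / 2)) ^ (-(1 : ℝ) / 2) *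
      (Real.log P) ^ ((1 : ℝ) / 4) * R < P ^ ((1 : ℝ) / 16)) :
    163 * (R ^ 4 * Real.log P) ≤ P ^ ((1 : ℝ) / 4) := by
  have hP1 : 1 ≤ P := by linarith
  have hP0 : 0 ≤ P := by linarith
  have hlog : 0 ≤ Real.log P := Real.log_nonneg hP1
  have hfac : 1 ≤ (1 - 2 / P₀ ^ ((1 : ℝ) / 2)) ^ (-(1 : ℝ) / 2) := by
    have h1 : 4 ≤ P₀ ^ ((1 : ℝ) / 2) := by
      rw [← Real.sqrt_eq_rpow]
      exact Real.le_sqrt_of_sq_le (by linarith)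
    have h2 : 2 / P₀ ^ ((1 : ℝ) / 2) ≤ 1 / 2 := by
      rw [div_le_div_iff₀ (by linarith) (by norm_num)]
      linarith
    have h3 : 0 ≤ 2 / P₀ ^ ((1 : ℝ) / 2) := by positivity
    exact Real.one_le_rpow_of_pos_of_le_one_of_nonpos (by linarith) (by linarith) (by norm_num)
  have hlog4 : ((Real.log P) ^ ((1 : ℝ) / 4)) ^ 4 = Real.log P := by
    rw [← Real.rpow_natCast, ← Real.rpow_mul hlog]
    norm_num
  have hP4 : (P ^ ((1 : ℝ) / 16)) ^ 4 = P ^ ((1 : ℝ) / 4) := by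
    rw [← Real.rpow_natCast, ← Real.rpow_mul hP0]
    norm_num
  have hl0 : 0 ≤ (Real.log P) ^ ((1 : ℝ) / 4) := Real.rpow_nonneg hlog _
  have h1 : 3.5751 * (Real.log P) ^ ((1 : ℝ) / 4) * R ≤ P ^ ((1 : ℝ) / 16) := by
    refine le_trans ?_ hcrit.le
    gcongr
    linarith
  have h2 := pow_le_pow_left₀ (by positivity) h1 4
  rw [hP4, mul_pow, mul_pow, hlog4] at h2
  have h3 : 0 ≤ Real.log P * R ^ 4 := by positivity
  nlinarith

end

theorem burgess_criterion (p₀ : ℝ) (hp₀ : (10 : ℝ) ^ 20 ≤ p₀)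
    (p : ℕ) (hp : p.Prime) (hpp₀ : (p : ℝ) > p₀)
    (hcrit : (p : ℝ) ^ ((1 : ℝ) / 16) >
      3.5751 * (1 - 2 / p₀ ^ ((1 : ℝ) / 2)) ^ (-(1 : ℝ) / 2) *
        (Real.log p) ^ ((1 : ℝ) / 4) *
        ((2 : ℝ) ^ (p - 1).primeFactors.card - 1)) :
    (leastPrimitiveRoot p : ℝ) < Real.sqrt p - 2 := by
  by_contra! hcon
  have : Fact p.Prime := ⟨hp⟩
  have hp20 : (10 : ℝ) ^ 20 ≤ p := by linarith
  have hp4 : 10000 ≤ p := by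
    have : (10000 : ℝ) ≤ p := by linarith
    exact_mod_cast this
  have hR0 : (0 : ℝ) ≤ 2 ^ (p - 1).primeFactors.card - 1 :=
    sub_nonneg.2 (one_le_pow₀ (by norm_num))
  have hRL := mul_pow_four_mul_log_le_of_criterion hp₀ hpp₀ hR0 hcrit
  obtain ⟨k, hk, hk1, hk2, hk3⟩ := exists_nat_fourth_power_bounds hp20
  have hkR : (50000 : ℝ) ≤ k := by exact_mod_cast hk
  have hkp : 16 * k ^ 4 ≤ p := by exact_mod_cast hk1
  have hsqrt : 4 * (k : ℝ) ^ 2 ≤ √p := Real.le_sqrt_of_sq_le (by linarith)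
  have hk0 : 50000 * 50000 ≤ k ^ 2 := by nlinarith
  have hk24 : 4 * k ^ 2 ≤ 16 * k ^ 4 := by nlinarith
  have hk3' : 2 * k * (2 * k ^ 2 - 3) < p := by
    calc 2 * k * (2 * k ^ 2 - 3) ≤ 2 * k * (2 * k ^ 2) :=
          Nat.mul_le_mul_left _ (Nat.sub_le _ _)
      _ = 4 * k ^ 3 := by ring
      _ < 16 * k ^ 4 := by
        rw [pow_succ k 3]
        have : 0 < k ^ 3 := by positivity
        nlinarith
      _ ≤ p := hkp
  have hmain := mul_pow_four_le_of_forall_orderOf_ne hp4 (A := 2 * k) (B := k)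
    (N := 2 * k ^ 2 - 3) (by omega) (by omega) (by omega) hk3' (by
      intro n hn0 hn
      have hAB : 2 * k * k = 2 * k ^ 2 := by ring
      have hn' : n + 3 ≤ 4 * k ^ 2 := by omega
      refine ⟨by omega, fun hord => ?_⟩
      have h1 : leastPrimitiveRoot p ≤ n := Nat.sInf_le ⟨hn0, hord⟩
      have h2 : (leastPrimitiveRoot p : ℝ) ≤ n := by exact_mod_cast h1
      have h3 : (n : ℝ) + 3 ≤ 4 * k ^ 2 := by exact_mod_cast hn'
      linarith)
  have hN : ((2 * k ^ 2 - 3 : ℕ) : ℝ) = 2 * (k : ℝ) ^ 2 - 3 := by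
    rw [Nat.cast_sub (by omega)]
    push_cast
    ring
  rw [hN] at hmain
  push_cast at hmain
  refine not_mul_pow_four_le_of_large hkR (Nat.cast_nonneg p) hk2 ?_ (hRL.trans hk3) hmain
  have hlog1 : 4 * Real.log (2 * k) ≤ Real.log p := by
    have h1 : Real.log ((2 * k) ^ 4) ≤ Real.log p :=
      Real.log_le_log (by positivity) (by linarith)
    rw [Real.log_pow] at h1
    exact_mod_cast h1
  have hlog2 : 4 ≤ Real.log p := by
    rw [Real.le_log_iff_exp_le (by linarith)]
    have h1 := pow_le_pow_left₀ (Real.exp_pos 1).le Real.exp_one_lt_three.le 4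
    rw [← Real.exp_nat_mul] at h1
    norm_num at h1
    linarith
  linarith
end

section
/- Let p be a prime, let e be an even divisor of p−1, let p_1, …, p_s (s ≥ 1) be the distinct primes dividing p−1 but not dividing e, and let N, H be integers with H ≥ 1. Then N_{p−1}(H) ≥ Σ_{i=1}^{s} N_{p_i e}(H) − (s−1)·N_e(H). -/
/-- An integer `x` (indivisible by `p`) is `e`-free if for every divisor `d > 1` of `e`
the congruence `x ≡ y ^ d (mod p)` has no solution `y`. -/
def IsEFree (p e : ℕ) (x : ℤ) : Prop :=
  ¬ (p : ℤ) ∣ x ∧ ∀ d : ℕ, d ∣ e → 1 < d → ¬ ∃ y : ℤ, Int.ModEq p x (y ^ d)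

/-- `NcountEFree p e N H` is the number of integers `x` with `N + 1 ≤ x ≤ N + H` that are
indivisible by `p` and `e`-free. -/
noncomputable def NcountEFree (p e : ℕ) (N H : ℤ) : ℕ :=
  {x : ℤ | N + 1 ≤ x ∧ x ≤ N + H ∧ IsEFree p e x}.ncard

theorem isEFree_iff_forall_prime {p n : ℕ} {x : ℤ} :
    IsEFree p n x ↔ ¬ (p : ℤ) ∣ x ∧
      ∀ q : ℕ, q.Prime → q ∣ n → ¬ ∃ y : ℤ, Int.ModEq p x (y ^ q) := by
  refine ⟨fun h => ⟨h.1, fun q hq hqn => h.2 q hqn hq.one_lt⟩, fun h => ⟨h.1, ?_⟩⟩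
  rintro d hdn hd ⟨y, hy⟩
  obtain ⟨q, hq, k, rfl⟩ := Nat.exists_prime_and_dvd hd.ne'
  exact h.2 q hq ((Dvd.intro k rfl).trans hdn) ⟨y ^ k, by rwa [← pow_mul, mul_comm k q]⟩

theorem IsEFree.of_dvd {p m n : ℕ} {x : ℤ} (h : IsEFree p n x) (hmn : m ∣ n) :
    IsEFree p m x :=
  ⟨h.1, fun d hd => h.2 d (hd.trans hmn)⟩

open Classical in
theorem ncountEFree_eq_sum (p e : ℕ) (N H : ℤ) :
    (NcountEFree p e N H : ℤ) =
      ∑ x ∈ Finset.Icc (N + 1) (N + H), if IsEFree p e x then 1 else 0 := by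
  rw [Finset.sum_boole, NcountEFree, ← Set.ncard_coe_finset]
  congr 2
  ext x
  simp [and_assoc]

theorem sieve_inequality (p : ℕ) (hp : p.Prime) (e : ℕ) (he : Even e) (hed : e ∣ p - 1)
    (s : ℕ) (hs : 1 ≤ s) (P : Fin s → ℕ)
    (hPinj : Function.Injective P)
    (hPprime : ∀ i, (P i).Prime)
    (hPdvd : ∀ i, P i ∣ p - 1)
    (hPnotdvd : ∀ i, ¬ P i ∣ e)
    (hPall : ∀ q : ℕ, q.Prime → q ∣ p - 1 → ¬ q ∣ e → ∃ i, P i = q)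
    (N H : ℤ) (hH : 1 ≤ H) :
    (NcountEFree p (p - 1) N H : ℤ) ≥
      (∑ i, (NcountEFree p (P i * e) N H : ℤ)) -
        ((s : ℤ) - 1) * (NcountEFree p e N H : ℤ) := by
  classical
  simp only [ncountEFree_eq_sum]
  rw [Finset.sum_comm, Finset.mul_sum, ← Finset.sum_sub_distrib]
  refine Finset.sum_le_sum fun x _ => ?_
  by_cases hx : IsEFree p e x
  · rw [Finset.sum_boole, if_pos hx]
    split_ifs with hfree
    · have hcard := Finset.card_filter_le (Finset.univ : Finset (Fin s))
        (fun i => IsEFree p (P i * e) x)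
      rw [Finset.card_univ, Fintype.card_fin] at hcard
      omega
    · have hex : ∃ i, ¬ IsEFree p (P i * e) x := by
        by_contra! hall
        refine hfree (isEFree_iff_forall_prime.2 ⟨hx.1, fun q hq hqp => ?_⟩)
        by_cases hqe : q ∣ e
        · exact hx.2 q hqe hq.one_lt
        · obtain ⟨i, rfl⟩ := hPall q hq hqp hqe
          exact (hall i).2 (P i) (Dvd.intro e rfl) hq.one_lt
      obtain ⟨i, hi⟩ := hex
      have hcard : (Finset.univ.filter fun i => IsEFree p (P i * e) x).card <
          (Finset.univ : Finset (Fin s)).card :=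
        Finset.card_lt_card (Finset.filter_ssubset.2 ⟨i, Finset.mem_univ i, hi⟩)
      rw [Finset.card_univ, Fintype.card_fin] at hcard
      omega
  · have hP (i : Fin s) : ¬ IsEFree p (P i * e) x :=
      fun h => hx (h.of_dvd (Dvd.intro_left (P i) rfl))
    simp only [hP, hx, if_false, Finset.sum_const_zero, mul_zero, sub_zero]
    split_ifs <;> norm_num
end

section
/- Let p be a prime, let e be an even divisor of p−1, let p_1, …, p_s (s ≥ 1) be the distinct primes dividing p−1 but not dividing e, let δ = 1 − Σ_{i=1}^{s} 1/p_i, and let N, H be integers with H ≥ 1. Then N_{p−1}(H) ≥ Σ_{i=1}^{s} [ N_{p_i e}(H) − (1 − 1/p_i)·N_e(H) ] + δ·N_e(H). -/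
theorem IsEFree.of_dvd_s7 {p d e : ℕ} {x : ℤ} (hde : d ∣ e) (h : IsEFree p e x) :
    IsEFree p d x :=
  ⟨h.1, fun k hk => h.2 k (hk.trans hde)⟩

theorem isEFree_of_forall_prime {p e : ℕ} {x : ℤ} (hx : ¬ (p : ℤ) ∣ x)
    (h : ∀ q : ℕ, q.Prime → q ∣ e → ¬ ∃ y : ℤ, Int.ModEq p x (y ^ q)) : IsEFree p e x := by
  refine ⟨hx, fun d hd hd1 ⟨y, hy⟩ => ?_⟩
  obtain ⟨k, hk⟩ := d.minFac_dvd
  refine h d.minFac (Nat.minFac_prime hd1.ne') (d.minFac_dvd.trans hd) ⟨y ^ k, ?_⟩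
  rwa [← pow_mul, mul_comm k, ← hk]

open Classical in
theorem NcountEFree_eq_card_filter (p e : ℕ) (N H : ℤ) :
    NcountEFree p e N H = ((Finset.Icc (N + 1) (N + H)).filter (IsEFree p e)).card := by
  rw [NcountEFree, ← Set.ncard_coe_finset]
  congr 1
  ext x
  simp [and_assoc]

/-- If the part of `A` lying in every `B i` is contained in `C`, then
`|A| ≤ |C| + ∑ i, (|A| - |B i|)`. -/
theorem Finset.card_le_card_add_sum_card_sub {α ι : Type*} [DecidableEq α] [Fintype ι]
    {A C : Finset α} {B : ι → Finset α} (hBA : ∀ i, B i ⊆ A)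
    (hC : ∀ x ∈ A, (∀ i, x ∈ B i) → x ∈ C) :
    (A.card : ℝ) ≤ C.card + ∑ i, ((A.card : ℝ) - (B i).card) := by
  have hsub : A ⊆ C ∪ Finset.univ.biUnion fun i => A \ B i := by
    intro x hx
    by_cases h : ∀ i, x ∈ B i
    · exact Finset.mem_union_left _ (hC x hx h)
    · push Not at h
      obtain ⟨i, hi⟩ := h
      exact Finset.mem_union_right _
        (Finset.mem_biUnion.2 ⟨i, Finset.mem_univ i, Finset.mem_sdiff.2 ⟨hx, hi⟩⟩)
  have hcard : A.card ≤ C.card + ∑ i, (A \ B i).card :=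
    (Finset.card_le_card hsub).trans
      ((Finset.card_union_le _ _).trans (Nat.add_le_add_left Finset.card_biUnion_le _))
  calc (A.card : ℝ) ≤ C.card + ∑ i, ((A \ B i).card : ℝ) := by exact_mod_cast hcard
    _ = C.card + ∑ i, ((A.card : ℝ) - (B i).card) := by
      simp_rw [Finset.cast_card_sdiff (hBA _)]

theorem sieve_inequality_delta (p : ℕ) (hp : p.Prime) (e : ℕ) (he : Even e)
    (hed : e ∣ p - 1)
    (s : ℕ) (hs : 1 ≤ s) (P : Fin s → ℕ)
    (hPinj : Function.Injective P)
    (hPprime : ∀ i, (P i).Prime)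
    (hPdvd : ∀ i, P i ∣ p - 1)
    (hPnotdvd : ∀ i, ¬ P i ∣ e)
    (hPall : ∀ q : ℕ, q.Prime → q ∣ p - 1 → ¬ q ∣ e → ∃ i, P i = q)
    (δ : ℝ) (hδ : δ = 1 - ∑ i, (1 : ℝ) / (P i))
    (N H : ℤ) (hH : 1 ≤ H) :
    (NcountEFree p (p - 1) N H : ℝ) ≥
      (∑ i, ((NcountEFree p (P i * e) N H : ℝ) -
          (1 - 1 / (P i : ℝ)) * (NcountEFree p e N H : ℝ))) +
        δ * (NcountEFree p e N H : ℝ) := by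
  classical
  simp only [NcountEFree_eq_card_filter]
  have key := Finset.card_le_card_add_sum_card_sub
    (A := (Finset.Icc (N + 1) (N + H)).filter (IsEFree p e))
    (B := fun i => (Finset.Icc (N + 1) (N + H)).filter (IsEFree p (P i * e)))
    (C := (Finset.Icc (N + 1) (N + H)).filter (IsEFree p (p - 1)))
    (fun i => Finset.monotone_filter_right _ fun _ _ h => h.of_dvd_s7 (dvd_mul_left e (P i)))
    (by
      intro x hx hB
      simp only [Finset.mem_filter] at hx hB ⊢
      refine ⟨hx.1, isEFree_of_forall_prime hx.2.1 fun q hq hqd => ?_⟩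
      by_cases hqe : q ∣ e
      · exact hx.2.2 q hqe hq.one_lt
      · obtain ⟨i, rfl⟩ := hPall q hq hqd hqe
        exact (hB i).2.2 (P i) (dvd_mul_right _ _) hq.one_lt)
  simp only [Finset.sum_sub_distrib, sub_mul, one_mul, ← Finset.sum_mul, hδ] at key ⊢
  linarith
end
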